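/- Let Λ be a rectangular lattice with basis (a, 0), (0, 1/a), a > 0, and let P = (p, r) be a collectively jammed packing of n disks in 𝕋² = ℝ²/Λ. If the n real numbers r₂/r₁, …, rₙ/r₁, a are generic (algebraically independent over ℚ), then the number of contacts of P is at most 2n. -/

import Mathlib

noncomputable section

open scoped RealInnerProductSpace

namespace IsostaticPaper

/-- Points of the Euclidean plane `ℝ²`. -/
abbrev Pt : Type := EuclideanSpace ℝ (Fin 2)

/-- The point `(x, y) ∈ ℝ²`. -/
def vec (x y : ℝ) : Pt := (WithLp.equiv 2 (Fin 2 → ℝ)).symm ![x, y]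

/-- The lattice `Λ ⊆ ℝ²` spanned over `ℤ` by the two vectors `v₁, v₂`. -/
def lat (v₁ v₂ : Pt) : Set Pt :=
  {l : Pt | ∃ z₁ z₂ : ℤ, l = (z₁ : ℝ) • v₁ + (z₂ : ℝ) • v₂}

/-- `(p, r)` is a packing of disks in the flat torus `ℝ²/Λ`:
all radii are positive and `‖pᵢ - pⱼ + λ‖ ≥ rᵢ + rⱼ` for all `i, j` and all
`λ ∈ Λ` with `(j, λ) ≠ (i, 0)`. -/
def IsPacking (Λ : Set Pt) {ι : Type} (p : ι → Pt) (r : ι → ℝ) : Prop :=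
  (∀ i, 0 < r i) ∧
  ∀ i j : ι, ∀ l ∈ Λ, ¬(j = i ∧ l = 0) → r i + r j ≤ ‖p i - p j + l‖

/-- A contact of the packing `(p, r)` is a triple `(i, j, λ)`, `λ ∈ Λ`,
`(j, λ) ≠ (i, 0)`, with `‖pᵢ - pⱼ + λ‖ = rᵢ + rⱼ`. -/
def IsContact (Λ : Set Pt) {ι : Type} (p : ι → Pt) (r : ι → ℝ) (c : ι × ι × Pt) : Prop :=
  c.2.2 ∈ Λ ∧ ¬(c.2.1 = c.1 ∧ c.2.2 = 0) ∧ ‖p c.1 - p c.2.1 + c.2.2‖ = r c.1 + r c.2.1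

/-- A packing `(p, r)` in `ℝ²/Λ` is collectively jammed if every continuous path of
configurations `t ↦ q t`, `t ∈ [0,1]`, starting at `p` and keeping `(q t, r)` a packing,
moves `p` only by translations. -/
def CollectivelyJammed (Λ : Set Pt) {ι : Type} (p : ι → Pt) (r : ι → ℝ) : Prop :=
  ∀ q : ℝ → ι → Pt,
    (∀ i, ContinuousOn (fun t => q t i) (Set.Icc 0 1)) →
    q 0 = p →
    (∀ t ∈ Set.Icc (0:ℝ) 1, IsPacking Λ (q t) r) →
    ∀ t ∈ Set.Icc (0:ℝ) 1, ∀ i j, q t i - p i = q t j - p j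

/-- Euclidean distance between two configurations of centers. -/
def pdist {ι : Type} [Fintype ι] (p q : ι → Pt) : ℝ :=
  Real.sqrt (∑ i, ‖p i - q i‖ ^ 2)

/-- Euclidean distance between two vectors of radii. -/
def rdist {ι : Type} [Fintype ι] (r s : ι → ℝ) : ℝ :=
  Real.sqrt (∑ i, (r i - s i) ^ 2)

/-- Determinant of the pair of lattice basis vectors `v₁, v₂`. -/
def det2 (v₁ v₂ : Pt) : ℝ := v₁ 0 * v₂ 1 - v₁ 1 * v₂ 0

/-- Density of a packing with radii `r` in the torus with lattice basis `v₁, v₂`. -/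
def density (v₁ v₂ : Pt) {ι : Type} [Fintype ι] (r : ι → ℝ) : ℝ :=
  Real.pi * (∑ i, r i ^ 2) / |det2 v₁ v₂|

/-- `(p, r)` is locally maximally dense in the torus with lattice basis `v₁, v₂`:
it is a packing and, for some `ε > 0`, every nearby packing whose radii are a positive
scalar multiple of `r` has density at most that of `(p, r)`. -/
def LocallyMaxDense (v₁ v₂ : Pt) {ι : Type} [Fintype ι] (p : ι → Pt) (r : ι → ℝ) : Prop :=
  IsPacking (lat v₁ v₂) p r ∧
  ∃ ε > 0, ∀ (q : ι → Pt) (t : ℝ), 0 < t →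
    IsPacking (lat v₁ v₂) q (fun i => t * r i) →
    pdist q p < ε → rdist (fun i => t * r i) r < ε →
    density v₁ v₂ (fun i => t * r i) ≤ density v₁ v₂ r

/-- An infinitesimal flex `p'` of the packing: `(pᵢ - pⱼ + λ) · (p'ᵢ - p'ⱼ) ≥ 0`
for every contact `(i, j, λ)`. -/
def IsInfFlex (Λ : Set Pt) {ι : Type} (p : ι → Pt) (r : ι → ℝ) (p' : ι → Pt) : Prop :=
  ∀ c : ι × ι × Pt, IsContact Λ p r c →
    0 ≤ ⟪p c.1 - p c.2.1 + c.2.2, p' c.1 - p' c.2.1⟫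

/-- The packing is infinitesimally rigid if every infinitesimal flex is trivial
(all `p'ᵢ` equal). -/
def InfinitesimallyRigid (Λ : Set Pt) {ι : Type} (p : ι → Pt) (r : ι → ℝ) : Prop :=
  ∀ p' : ι → Pt, IsInfFlex Λ p r p' → ∀ i j, p' i = p' j

/-- The space of equilibrium stresses of a packing whose (finite) set of ordered
contact triples is `K`: scalars on contacts with `ω(i,j,λ) = ω(j,i,-λ)`, vanishing off
`K`, in equilibrium at every vertex. -/
def stressSpace {n : ℕ} (K : Finset (Fin n × Fin n × Pt)) (p : Fin n → Pt) :
    Submodule ℝ ((Fin n × Fin n × Pt) → ℝ) where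
  carrier := {ω | (∀ c ∉ K, ω c = 0) ∧
    (∀ i j l, ω (i, j, l) = ω (j, i, -l)) ∧
    (∀ i, ∑ c ∈ K.filter (fun c => c.1 = i), ω c • (p c.1 - p c.2.1 + c.2.2) = 0)}
  zero_mem' := ⟨fun _ _ => rfl, fun _ _ _ => rfl, fun i => by simp⟩
  add_mem' := by
    rintro ω₁ ω₂ ⟨h1, h2, h3⟩ ⟨g1, g2, g3⟩
    refine ⟨fun c hc => ?_, fun i j l => ?_, fun i => ?_⟩
    · simp [h1 c hc, g1 c hc]
    · simp [h2 i j l, g2 i j l]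
    · simp only [Pi.add_apply, add_smul, Finset.sum_add_distrib, h3 i, g3 i, add_zero]
  smul_mem' := by
    rintro t ω ⟨h1, h2, h3⟩
    refine ⟨fun c hc => ?_, fun i j l => ?_, fun i => ?_⟩
    · simp [h1 c hc]
    · simp [h2 i j l]
    · simp only [Pi.smul_apply, smul_assoc, ← Finset.smul_sum, h3 i, smul_zero]


theorem exists_ringHom_section {S A B : Type} [CommRing S] [CommRing A] [CommRing B]
    [Algebra S A] [Algebra.FormallySmooth S A] (φ : S →+* B) (g : B →+* A)
    (hg : Function.Surjective g) (hn : IsNilpotent (RingHom.ker g))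
    (hφ : g.comp φ = algebraMap S A) :
    ∃ h : A →+* B, (∀ x, g (h x) = x) ∧ ∀ s, h (algebraMap S A s) = φ s := by
  let : Algebra S B := φ.toAlgebra
  let g' : B →ₐ[S] A := { g with commutes' := fun s => congrArg (· s) hφ }
  let h := Algebra.FormallySmooth.liftOfSurjective (AlgHom.id S A) g' hg hn
  exact ⟨h, fun x => Algebra.FormallySmooth.liftOfSurjective_apply _ g' hg hn x,
    fun s => h.commutes s⟩

open scoped IntermediateField.algebraAdjoinAdjoin in
theorem formallySmooth_adjoin_of_algebraicIndependent {ι : Type} {x : ι → ℝ} :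
    Algebra.FormallySmooth (Algebra.adjoin ℚ (Set.range x)) ℝ := by
  have h1 : Algebra.FormallySmooth (Algebra.adjoin ℚ (Set.range x))
      (IntermediateField.adjoin ℚ (Set.range x)) :=
    .of_isLocalization (nonZeroDivisors _)
  obtain ⟨T, hT⟩ := exists_isTranscendenceBasis (IntermediateField.adjoin ℚ (Set.range x)) ℝ
  have := hT.isAlgebraic_field
  have : Algebra.FormallySmooth (IntermediateField.adjoin ℚ (Set.range x)) ℝ :=
    .of_algebraicIndependent_of_isSeparable hT.1
  exact .comp _ (IntermediateField.adjoin ℚ (Set.range x)) _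

theorem exists_derivation_of_algebraicIndependent {ι : Type} {x : ι → ℝ}
    (hx : AlgebraicIndependent ℚ x) (t : ι → ℝ) :
    ∃ D : ℝ → ℝ, (∀ u v, D (u + v) = D u + D v) ∧ (∀ u v, D (u * v) = u * D v + v * D u) ∧
      ∀ i, D (x i) = t i := by
  have := formallySmooth_adjoin_of_algebraicIndependent (x := x)
  let φ : Algebra.adjoin ℚ (Set.range x) →ₐ[ℚ] DualNumber ℝ :=
    (MvPolynomial.aeval fun i => (TrivSqZeroExt.inl (x i) + TrivSqZeroExt.inr (t i) :
      DualNumber ℝ)).comp hx.aevalEquiv.symm.toAlgHom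
  have hφx : ∀ i, φ ⟨x i, Algebra.subset_adjoin ⟨i, rfl⟩⟩ =
      TrivSqZeroExt.inl (x i) + TrivSqZeroExt.inr (t i) := by
    intro i
    have : hx.aevalEquiv.symm ⟨x i, Algebra.subset_adjoin ⟨i, rfl⟩⟩ = MvPolynomial.X i := by
      rw [AlgEquiv.symm_apply_eq]
      apply Subtype.ext
      simp
    simp [φ, this]
  let g : DualNumber ℝ →ₐ[ℚ] ℝ := TrivSqZeroExt.fstHom ℚ ℝ ℝ
  have hgφ : g.comp φ = (Algebra.adjoin ℚ (Set.range x)).val := by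
    apply AlgHom.adjoin_ext
    rintro _ ⟨i, rfl⟩
    rw [AlgHom.comp_apply, hφx]
    simp [g]
  obtain ⟨h, h1, h2⟩ := exists_ringHom_section (A := ℝ) (φ : _ →+* DualNumber ℝ) (g : _ →+* ℝ)
    (fun y => ⟨TrivSqZeroExt.inl y, rfl⟩) (by
      refine ⟨2, ?_⟩
      rw [pow_two, Ideal.zero_eq_bot, eq_bot_iff, Ideal.mul_le]
      intro u hu v hv
      have hu' : u.fst = 0 := hu
      have hv' : v.fst = 0 := hv
      rw [Ideal.mem_bot]
      ext <;> simp [hu', hv'])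
    (by ext s; exact congrArg (fun f : _ →ₐ[ℚ] ℝ => f s) hgφ)
  have hf : ∀ u, (h u).fst = u := h1
  refine ⟨fun u => (h u).snd, fun u v => by simp, fun u v => by simp [hf, mul_comm], fun i => ?_⟩
  have := h2 ⟨x i, Algebra.subset_adjoin ⟨i, rfl⟩⟩
  have e : h (x i) = _ := this.trans (hφx i)
  simp [e]

/-- The real inner product of two complex numbers. -/
def dot (u v : ℂ) : ℝ := u.re * v.re + u.im * v.im

/-- The vector of the rectangular lattice `b₁ ℤ + b₂ i ℤ` with coordinates `z`. -/
def rectVec (b₁ b₂ : ℝ) (z : ℤ × ℤ) : ℂ := ⟨z.1 * b₁, z.2 * b₂⟩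

/-- A packing of disks in a rectangular torus (drawn in the complex plane), together with a
finite symmetric family `C` of oriented contacts and a weight `w` on it which is an equilibrium
stress for motions of the centers, changes of the radii and deformations of the lattice. -/
structure StressedPacking (ι C : Type) [Fintype C] where
  P : ι → ℂ
  r : ι → ℝ
  b₁ : ℝ
  b₂ : ℝ
  r_pos : ∀ i, 0 < r i
  b₁_pos : 0 < b₁
  b₂_pos : 0 < b₂
  pack : ∀ i j z, ¬(j = i ∧ z = 0) → r i + r j ≤ ‖P i - P j + rectVec b₁ b₂ z‖
  s : C → ι
  l : C → ℤ × ℤ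
  rev : C → C
  rev_rev : ∀ c, rev (rev c) = c
  l_rev : ∀ c, l (rev c) = -l c
  contact_ext : ∀ c c', s c = s c' → s (rev c) = s (rev c') → l c = l c' → c = c'
  contact : ∀ c, ‖P (s c) - P (s (rev c)) + rectVec b₁ b₂ (l c)‖ = r (s c) + r (s (rev c))
  w : C → ℝ
  w_rev : ∀ c, w (rev c) = w c
  equilibrium : ∀ f : ι → ℝ,
    ∑ c, (w c * f (s c)) • (P (s c) - P (s (rev c)) + rectVec b₁ b₂ (l c)) = 0
  equilibrium_radius : ∀ f : ι → ℝ, ∑ c, w c * f (s c) * (r (s c) + r (s (rev c))) = 0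
  equilibrium_re : ∑ c, (w c * (P (s c) - P (s (rev c)) + rectVec b₁ b₂ (l c)).re) •
    (P (s c) - P (s (rev c)) + rectVec b₁ b₂ (l c)) = 0
  equilibrium_im : ∑ c, (w c * (P (s c) - P (s (rev c)) + rectVec b₁ b₂ (l c)).im) •
    (P (s c) - P (s (rev c)) + rectVec b₁ b₂ (l c)) = 0

theorem card_add_finrank_le {E F ι : Type} [AddCommGroup E] [Module ℝ E] [FiniteDimensional ℝ E]
    [AddCommGroup F] [Module ℝ F] [FiniteDimensional ℝ F] [Fintype ι]
    (R : E →ₗ[ℝ] ι → ℝ) (hR : Function.Surjective R) (Θ : E → F)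
    (hadd : ∀ x y, Θ (x + y) = Θ x + Θ y)
    (hsmul : ∀ (t : ℝ) x, Θ (t • x) = t • Θ x)
    (hΘ : ∀ y, ∃ x, R x = 0 ∧ Θ x = y) :
    Fintype.card ι + Module.finrank ℝ F ≤ Module.finrank ℝ E := by
  let Θ' : E →ₗ[ℝ] F := ⟨⟨Θ, hadd⟩, hsmul⟩
  have h1 := LinearMap.finrank_range_add_finrank_ker R
  rw [LinearMap.range_eq_top.2 hR, finrank_top, Module.finrank_fintype_fun_eq_card] at h1
  have h2 := LinearMap.finrank_le_finrank_of_surjective (f := Θ'.comp (LinearMap.ker R).subtype)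
    fun y => by
      obtain ⟨x, hx, hy⟩ := hΘ y
      exact ⟨⟨x, hx⟩, hy⟩
  omega

theorem exists_functional_of_not_surjective {E ι : Type} [AddCommGroup E] [Module ℝ E] [Fintype ι]
    (R : E →ₗ[ℝ] ι → ℝ) (hR : ¬ Function.Surjective R) :
    ∃ w : ι → ℝ, w ≠ 0 ∧ ∀ x, ∑ i, w i * R x i = 0 := by
  classical
  have : LinearMap.range R < ⊤ := lt_top_iff_ne_top.2 fun h => hR (LinearMap.range_eq_top.1 h)
  obtain ⟨f, hf, hf'⟩ := Submodule.exists_le_ker_of_lt_top _ this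
  have key : ∀ v : ι → ℝ, f v = ∑ i, f (Pi.single i 1) * v i := by
    intro v
    conv_lhs => rw [pi_eq_sum_univ' v]
    rw [map_sum]
    refine Finset.sum_congr rfl fun i _ => ?_
    rw [map_smul, smul_eq_mul, mul_comm]
  refine ⟨fun i => f (Pi.single i 1), fun h => hf ?_, fun x => ?_⟩
  · ext v
    simpa using congrFun h v
  · rw [← key]
    exact hf' ⟨x, rfl⟩

theorem exists_half {α : Type} (K : Finset α) (rev : α → α)
    (hK : ∀ c ∈ K, rev c ∈ K) (hrr : ∀ c, rev (rev c) = c) (hne : ∀ c ∈ K, rev c ≠ c) :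
    ∃ H ⊆ K, (∀ c ∈ K, c ∈ H ↔ rev c ∉ H) ∧ K.card = 2 * H.card := by
  classical
  let H := K.filter fun c => WellOrderingRel c (rev c)
  have hH : ∀ c ∈ K, c ∈ H ↔ rev c ∉ H := by
    intro c hc
    simp only [H, Finset.mem_filter, hc, hK c hc, true_and, hrr]
    refine ⟨fun h => asymm h, fun h => ?_⟩
    rcases trichotomous_of WellOrderingRel c (rev c) with h' | h' | h'
    · exact h'
    · exact absurd h'.symm (hne c hc)
    · exact absurd h' h
  have hsub : H ⊆ K := Finset.filter_subset _ _
  refine ⟨H, hsub, hH, ?_⟩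
  have h1 := Finset.card_sdiff_add_card_eq_card hsub
  have h2 : (K \ H).card = H.card := by
    refine Finset.card_bij' (fun c _ => rev c) (fun c _ => rev c) ?_ ?_ ?_ ?_
    · intro c hc
      rw [Finset.mem_sdiff] at hc
      by_contra h
      exact hc.2 ((hH c hc.1).2 h)
    · intro c hc
      rw [Finset.mem_sdiff]
      exact ⟨hK c (hsub hc), (hH c (hsub hc)).1 hc⟩
    · simp [hrr]
    · simp [hrr]
  omega

/-- The first order change of `(‖d‖² - L²) / 2` along an infinitesimal motion of the centers,
the radii and the lattice vectors, where `d` and `L` are the difference of the centers and the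
sum of the radii for the contact `c`. -/
def contactDeriv {n : ℕ} (P : Fin n → ℂ) (r : Fin n → ℝ) (b₁ b₂ : ℝ) (c : Fin n × Fin n × ℤ × ℤ)
    (m : (Fin n → ℂ) × (Fin n → ℝ) × ℂ × ℂ) : ℝ :=
  dot (P c.1 - P c.2.1 + rectVec b₁ b₂ c.2.2)
    (m.1 c.1 - m.1 c.2.1 + (c.2.2.1 : ℝ) • m.2.2.1 + (c.2.2.2 : ℝ) • m.2.2.2) -
  (r c.1 + r c.2.1) * (m.2.1 c.1 + m.2.1 c.2.1)

/-- The reversal of an oriented contact. -/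
def contactRev {n : ℕ} (c : Fin n × Fin n × ℤ × ℤ) : Fin n × Fin n × ℤ × ℤ := (c.2.1, c.1, -c.2.2)

theorem contactRev_contactRev {n : ℕ} (c : Fin n × Fin n × ℤ × ℤ) :
    contactRev (contactRev c) = c := by
  simp [contactRev]

theorem rectVec_neg (b₁ b₂ : ℝ) (z : ℤ × ℤ) : rectVec b₁ b₂ (-z) = -rectVec b₁ b₂ z := by
  apply Complex.ext <;> simp [rectVec]

/-- The embedding of `Fin (n - 1)` as the positive elements of `Fin n`. -/
def positive {n : ℕ} (hn : 0 < n) (i : Fin (n - 1)) : Fin n := i.succ.cast (Nat.sub_add_cancel hn)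

theorem contactDeriv_surjective_on_shapes {n : ℕ} (hn : 0 < n) {a : ℝ} (ha : 0 < a)
    (P : Fin n → ℂ) (r : Fin n → ℝ) (hr : ∀ i, 0 < r i)
    (hgen : AlgebraicIndependent ℚ fun x : Option (Fin (n - 1)) =>
      x.elim a fun i => r (positive hn i) / r ⟨0, hn⟩)
    (K : Finset (Fin n × Fin n × ℤ × ℤ))
    (hK : ∀ c ∈ K, ‖P c.1 - P c.2.1 + rectVec a (1 / a) c.2.2‖ = r c.1 + r c.2.1)
    (y : (Fin (n - 1) → ℝ) × ℝ × ℝ × ℝ × ℂ) :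
    ∃ m : (Fin n → ℂ) × (Fin n → ℝ) × ℂ × ℂ, (∀ c ∈ K, contactDeriv P r a (1 / a) c m = 0) ∧
      (fun i : Fin (n - 1) => (m.2.1 (positive hn i) * r ⟨0, hn⟩ -
          r (positive hn i) * m.2.1 ⟨0, hn⟩) / r ⟨0, hn⟩ ^ 2,
        (m.2.2.1.re - a ^ 2 * m.2.2.2.im) / 2, (m.2.2.1.re / a + a * m.2.2.2.im) / 2,
        m.2.2.1.im / a, m.1 ⟨0, hn⟩) = y := by
  obtain ⟨t, A, σ, τ, q⟩ := y
  obtain ⟨D, hadd, hmul, hD⟩ := exists_derivation_of_algebraicIndependent hgen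
    (fun x => x.elim A t)
  have hDa : D a = A := hD none
  have hDt : ∀ i : Fin (n - 1), D (r (positive hn i) / r ⟨0, hn⟩) = t i :=
    fun i => hD (some i)
  have ha' := ha.ne'
  let D' : ℝ →+ ℝ := AddMonoidHom.mk' D hadd
  have hsub : ∀ u v, D (u - v) = D u - D v := fun u v => map_sub D' u v
  have hint : ∀ (k : ℤ) u, D (k * u) = k * D u := fun k u => by
    have := map_zsmul D' k u
    rw [zsmul_eq_mul, zsmul_eq_mul] at this
    exact this
  have h1 : D 1 = 0 := by
    have := hmul 1 1
    simp at this
    exact this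
  have hinv : D (1 / a) = -A / a ^ 2 := by
    have h := hmul a (1 / a)
    rw [mul_one_div_cancel ha', h1, hDa] at h
    field_simp at h ⊢
    linarith
  let p' : Fin n → ℂ := fun i => ⟨D (P i).re + σ * (P i).re - τ * (P i).im,
    D (P i).im + σ * (P i).im + τ * (P i).re⟩
  refine ⟨(fun i => p' i - p' ⟨0, hn⟩ + q, fun i => D (r i) + σ * r i, ⟨A + σ * a, τ * a⟩,
    ⟨-(τ / a), -A / a ^ 2 + σ / a⟩), fun c hc => ?_, ?_⟩
  · have h := hK c hc
    obtain ⟨i, j, z⟩ := c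
    set L := r i + r j with hL
    have hLD : D (r i) + D (r j) = D L := (hadd _ _).symm
    set d := P i - P j + rectVec a (1 / a) z with hd
    have hdr : D (P i).re - D (P j).re + z.1 * A = D d.re := by
      simp [hd, rectVec, hadd, hsub, hint, hDa]
    have hdi : D (P i).im - D (P j).im + z.2 * (-A / a ^ 2) = D d.im := by
      simp only [hd, rectVec, hadd, hsub, hint, hinv, Complex.add_im, Complex.sub_im]
    have h2 : d.re * d.re + d.im * d.im = L * L := by
      have := Complex.sq_norm d
      rw [Complex.normSq_apply, show ‖d‖ = L from h] at this
      linarith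
    have h3 : d.re * D d.re + d.im * D d.im = L * D L := by
      have := congrArg D h2
      rw [hadd, hmul, hmul, hmul] at this
      linarith
    have er : d.re = (P i).re - (P j).re + z.1 * a := by simp [hd, rectVec]
    have ei : d.im = (P i).im - (P j).im + z.2 * (1 / a) := by simp [hd, rectVec]
    have e : contactDeriv P r a (1 / a) (i, j, z) (fun i => p' i - p' ⟨0, hn⟩ + q,
        fun i => D (r i) + σ * r i, ⟨A + σ * a, τ * a⟩, ⟨-(τ / a), -A / a ^ 2 + σ / a⟩) =
        d.re * (D d.re + σ * d.re - τ * d.im) + d.im * (D d.im + σ * d.im + τ * d.re) -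
        L * (D L + σ * L) := by
      have k1 : D d.re + σ * d.re - τ * d.im = (p' i - p' ⟨0, hn⟩ + q - (p' j - p' ⟨0, hn⟩ + q) +
          (z.1 : ℝ) • (⟨A + σ * a, τ * a⟩ : ℂ) +
          (z.2 : ℝ) • (⟨-(τ / a), -A / a ^ 2 + σ / a⟩ : ℂ)).re := by
        rw [← hdr]
        simp only [p', er, ei, Complex.add_re, Complex.sub_re, Complex.smul_re, smul_eq_mul]
        ring
      have k2 : D d.im + σ * d.im + τ * d.re = (p' i - p' ⟨0, hn⟩ + q - (p' j - p' ⟨0, hn⟩ + q) +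
          (z.1 : ℝ) • (⟨A + σ * a, τ * a⟩ : ℂ) +
          (z.2 : ℝ) • (⟨-(τ / a), -A / a ^ 2 + σ / a⟩ : ℂ)).im := by
        rw [← hdi]
        simp only [p', er, ei, Complex.add_im, Complex.sub_im, Complex.smul_im, smul_eq_mul]
        ring
      rw [k1, k2, ← hLD, contactDeriv, dot]
      simp only [← hL, ← hd]
      rw [hL]
      ring
    rw [e]
    linear_combination h3 + σ * h2
  · ext
    · rename_i i
      have h0 := (hr ⟨0, hn⟩).ne'
      have h := hmul (r (positive hn i) / r ⟨0, hn⟩) (r ⟨0, hn⟩)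
      rw [div_mul_cancel₀ _ h0, hDt] at h
      simp only [h]
      field_simp
      ring
    · simp only
      field_simp
      ring
    · simp only
      field_simp
      ring
    · simp only
      field_simp
    · simp

theorem card_le_of_weight_eq_zero {n : ℕ} (hn : 0 < n) {a : ℝ} (ha : 0 < a)
    (P : Fin n → ℂ) (r : Fin n → ℝ) (hr : ∀ i, 0 < r i)
    (hpack : ∀ i j z, ¬(j = i ∧ z = 0) → r i + r j ≤ ‖P i - P j + rectVec a (1 / a) z‖)
    (hgen : AlgebraicIndependent ℚ fun x : Option (Fin (n - 1)) =>
      x.elim a fun i => r (positive hn i) / r ⟨0, hn⟩)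
    (K : Finset (Fin n × Fin n × ℤ × ℤ))
    (hK : ∀ c ∈ K, ‖P c.1 - P c.2.1 + rectVec a (1 / a) c.2.2‖ = r c.1 + r c.2.1)
    (hrev : ∀ c ∈ K, contactRev c ∈ K)
    (hw : ∀ (S : StressedPacking (Fin n) {c // c ∈ K}) c, S.w c = 0) :
    K.card ≤ 2 * (2 * n) := by
  classical
  obtain ⟨H, hHK, hH, hcard⟩ := exists_half K contactRev hrev contactRev_contactRev (by
    rintro ⟨i, j, z⟩ hc h
    simp only [contactRev, Prod.mk.injEq] at h
    obtain ⟨rfl, -, h⟩ := h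
    have h0 : z = 0 := by
      have := congrArg Prod.fst h
      have := congrArg Prod.snd h
      ext <;> simp at * <;> omega
    have := hr j
    have h2 : rectVec a (1 / a) 0 = 0 := by simp [rectVec, Complex.ext_iff]
    have h3 := hK _ hc
    simp only [h0, h2, sub_self, add_zero, norm_zero] at h3
    linarith)
  let R : ((Fin n → ℂ) × (Fin n → ℝ) × ℂ × ℂ) →ₗ[ℝ] ({c // c ∈ H} → ℝ) :=
    { toFun := fun m c => contactDeriv P r a (1 / a) c.1 m
      map_add' := fun m m' => by
        ext c
        simp [contactDeriv, dot]
        ring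
      map_smul' := fun t m => by
        ext c
        simp [contactDeriv, dot]
        ring }
  by_cases hR : Function.Surjective R
  · have := card_add_finrank_le (F := (Fin (n - 1) → ℝ) × ℝ × ℝ × ℝ × ℂ) R hR
      (fun m => (fun i : Fin (n - 1) => (m.2.1 (positive hn i) *
          r ⟨0, hn⟩ - r (positive hn i) * m.2.1 ⟨0, hn⟩) / r ⟨0, hn⟩ ^ 2,
        (m.2.2.1.re - a ^ 2 * m.2.2.2.im) / 2, (m.2.2.1.re / a + a * m.2.2.2.im) / 2,
        m.2.2.1.im / a, m.1 ⟨0, hn⟩))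
      (fun x y => by ext <;> simp <;> ring) (fun t x => by ext <;> simp <;> ring)
      (fun y => by
        obtain ⟨m, hm, hm'⟩ := contactDeriv_surjective_on_shapes hn ha P r hr hgen K hK y
        exact ⟨m, funext fun c => hm c.1 (hHK c.2), hm'⟩)
    simp [Module.finrank_pi_fintype] at this
    omega
  · exfalso
    obtain ⟨u, hu0, hu⟩ := exists_functional_of_not_surjective R hR
    let u' : Fin n × Fin n × ℤ × ℤ → ℝ := fun c => if h : c ∈ H then u ⟨c, h⟩ else 0
    have hu' : ∀ m, ∑ c ∈ K, u' c * contactDeriv P r a (1 / a) c m = 0 := by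
      intro m
      rw [← hu m, ← Finset.sum_subset hHK, ← Finset.sum_coe_sort]
      · refine Finset.sum_congr rfl fun c _ => ?_
        simp [u', R]
      · intro c _ hc
        simp [u', hc]
    have hsum : ∀ F : Fin n × Fin n × ℤ × ℤ → ℝ,
        ∑ c ∈ K, F (contactRev c) = ∑ c ∈ K, F c := fun F =>
      Finset.sum_nbij' contactRev contactRev hrev hrev (fun c _ => contactRev_contactRev c)
        (fun c _ => contactRev_contactRev c) (fun c _ => rfl)
    have hsum2 : ∀ F : Fin n × Fin n × ℤ × ℤ → ℝ,
        ∑ c ∈ K, (u' c + u' (contactRev c)) * F c =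
        ∑ c ∈ K, u' c * (F c + F (contactRev c)) := fun F => by
      simp only [add_mul, mul_add, Finset.sum_add_distrib]
      rw [← hsum fun c => u' (contactRev c) * F c]
      simp only [contactRev_contactRev]
    let d : Fin n × Fin n × ℤ × ℤ → ℂ := fun c => P c.1 - P c.2.1 + rectVec a (1 / a) c.2.2
    have hvec : ∀ F : Fin n × Fin n × ℤ × ℤ → ℝ,
        (∀ e : ℂ, ∑ c ∈ K, (u' c + u' (contactRev c)) * (F c * dot (d c) e) = 0) →
        ∑ c : {c // c ∈ K}, ((u' c.1 + u' (contactRev c.1)) * F c) • d c = 0 := by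
      intro F hF
      rw [Finset.sum_coe_sort K fun c => ((u' c + u' (contactRev c)) * F c) • d c]
      apply Complex.ext
      · simpa [dot, mul_assoc] using hF 1
      · simpa [dot, mul_assoc] using hF Complex.I
    let S : StressedPacking (Fin n) {c // c ∈ K} :=
      { P := P
        r := r
        b₁ := a
        b₂ := 1 / a
        r_pos := hr
        b₁_pos := ha
        b₂_pos := by positivity
        pack := hpack
        s := fun c => c.1.1
        l := fun c => c.1.2.2
        rev := fun c => ⟨contactRev c.1, hrev _ c.2⟩
        rev_rev := fun c => Subtype.ext (contactRev_contactRev _)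
        l_rev := fun c => rfl
        contact_ext := fun c c' h1 h2 h3 => Subtype.ext (Prod.ext h1 (Prod.ext h2 h3))
        contact := fun c => hK c.1 c.2
        w := fun c => u' c.1 + u' (contactRev c.1)
        w_rev := fun c => by rw [contactRev_contactRev, add_comm]
        equilibrium := fun f => hvec (fun c => f c.1) fun e => by
          rw [hsum2, ← hu' (fun i => (f i : ℝ) • e, 0, 0, 0)]
          refine Finset.sum_congr rfl fun c _ => congrArg (u' c * ·) ?_
          simp [contactDeriv, dot, d, contactRev, rectVec_neg]
          ring
        equilibrium_radius := fun f => by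
          have := hsum2 fun c => f c.1 * (r c.1 + r c.2.1)
          have h2 := hu' (0, f, 0, 0)
          rw [← neg_eq_zero, ← Finset.sum_neg_distrib] at h2
          refine Eq.trans ?_ (this.trans (Eq.trans ?_ h2))
          · rw [← Finset.sum_coe_sort K]
            refine Finset.sum_congr rfl fun c _ => ?_
            simp only [contactRev]
            ring
          · refine Finset.sum_congr rfl fun c _ => ?_
            rw [← mul_neg]
            refine congrArg (u' c * ·) ?_
            simp [contactDeriv, dot, contactRev]
            ring
        equilibrium_re := hvec (fun c => (d c).re) fun e => by
          have h2 := hu' (fun i => (P i).re • e, 0, a • e, 0)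
          rw [hsum2, ← mul_zero (2 : ℝ), ← h2, Finset.mul_sum]
          refine Finset.sum_congr rfl fun c _ => ?_
          simp [contactDeriv, dot, d, contactRev, rectVec]
          ring
        equilibrium_im := hvec (fun c => (d c).im) fun e => by
          have h2 := hu' (fun i => (P i).im • e, 0, 0, (1 / a) • e)
          rw [hsum2, ← mul_zero (2 : ℝ), ← h2, Finset.mul_sum]
          refine Finset.sum_congr rfl fun c _ => ?_
          simp [contactDeriv, dot, d, contactRev, rectVec]
          ring }
    apply hu0
    ext ⟨c, hc⟩
    have h1 := hw S ⟨c, hHK hc⟩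
    have h2 : contactRev c ∉ H := (hH c (hHK hc)).1 hc
    simpa [S, u', hc, h2] using h1

namespace StressedPacking

variable {ι C : Type} [Fintype C] (S : StressedPacking ι C)

/-- The lattice vector with coordinates `z`. -/
def lam (z : ℤ × ℤ) : ℂ := rectVec S.b₁ S.b₂ z

/-- The length of a contact. -/
def L (c : C) : ℝ := S.r (S.s c) + S.r (S.s (S.rev c))

/-- The direction of a contact. -/
def u (c : C) : ℂ := (S.L c)⁻¹ • (S.P (S.s (S.rev c)) - S.P (S.s c) - S.lam (S.l c))

/-- The direction of a contact, turned by a right angle. -/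
def nor (c : C) : ℂ := Complex.I * S.u c

/-- The tension in a contact. -/
def W (c : C) : ℝ := S.w c * S.L c

theorem L_pos (c : C) : 0 < S.L c := add_pos (S.r_pos _) (S.r_pos _)

theorem smul_L_u (c : C) :
    S.L c • S.u c = S.P (S.s (S.rev c)) - S.P (S.s c) - S.lam (S.l c) := by
  rw [u, smul_inv_smul₀ (S.L_pos c).ne']

theorem diff_eq (c : C) :
    S.P (S.s c) - S.P (S.s (S.rev c)) + rectVec S.b₁ S.b₂ (S.l c) = -(S.L c • S.u c) := by
  rw [smul_L_u, lam]
  ring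

theorem norm_u (c : C) : ‖S.u c‖ = 1 := by
  have h := S.contact c
  rw [diff_eq, norm_neg, norm_smul, Real.norm_of_nonneg (S.L_pos c).le] at h
  exact (mul_eq_left₀ (S.L_pos c).ne').1 h

theorem lam_neg (z : ℤ × ℤ) : S.lam (-z) = -S.lam z := rectVec_neg _ _ _

theorem lam_zero : S.lam 0 = 0 := by simp [lam, rectVec, Complex.ext_iff]

theorem lam_add (z z' : ℤ × ℤ) : S.lam (z + z') = S.lam z + S.lam z' := by
  apply Complex.ext <;> simp [lam, rectVec, add_mul]

theorem lam_sub (z z' : ℤ × ℤ) : S.lam (z - z') = S.lam z - S.lam z' := by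
  rw [sub_eq_add_neg, lam_add, lam_neg, sub_eq_add_neg]

theorem L_rev (c : C) : S.L (S.rev c) = S.L c := by
  rw [L, L, S.rev_rev, add_comm]

theorem u_rev (c : C) : S.u (S.rev c) = -S.u c := by
  rw [u, L_rev, S.rev_rev, S.l_rev, lam_neg, u, ← smul_neg]
  congr 1
  ring

theorem nor_rev (c : C) : S.nor (S.rev c) = -S.nor c := by
  rw [nor, u_rev, mul_neg, nor]

theorem W_rev (c : C) : S.W (S.rev c) = S.W c := by
  rw [W, W, L_rev, S.w_rev]

theorem sum_rev {E : Type} [AddCommMonoid E] (f : C → E) : ∑ c, f (S.rev c) = ∑ c, f c :=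
  Equiv.sum_comp (Function.Involutive.toPerm S.rev S.rev_rev) f

theorem sum_W_smul_u (f : ι → ℝ) : ∑ c, (S.W c * f (S.s c)) • S.u c = 0 := by
  have h := S.equilibrium f
  rw [← neg_eq_zero, ← Finset.sum_neg_distrib] at h
  rw [← h]
  refine Finset.sum_congr rfl fun c _ => ?_
  rw [diff_eq, smul_neg, neg_neg, smul_smul, W]
  ring_nf

theorem sum_W_smul_nor (f : ι → ℝ) : ∑ c, (S.W c * f (S.s c)) • S.nor c = 0 := by
  have h := congrArg (Complex.I * ·) (S.sum_W_smul_u f)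
  simp only [mul_zero, Finset.mul_sum, mul_smul_comm] at h
  exact h

theorem sum_W (f : ι → ℝ) : ∑ c, S.W c * f (S.s c) = 0 := by
  rw [← S.equilibrium_radius f]
  refine Finset.sum_congr rfl fun c _ => ?_
  rw [W, L]
  ring

theorem sum_W_L_re : ∑ c, (S.W c * S.L c * (S.u c).re) • S.nor c = 0 := by
  have h := congrArg (Complex.I * ·) S.equilibrium_re
  simp only [mul_zero, Finset.mul_sum, mul_smul_comm] at h
  rw [← h]
  refine Finset.sum_congr rfl fun c _ => ?_
  rw [diff_eq, W, nor, mul_neg, mul_smul_comm, smul_neg, smul_smul, ← neg_smul]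
  congr 1
  simp
  ring

theorem sum_W_L_im : ∑ c, (S.W c * S.L c * (S.u c).im) • S.nor c = 0 := by
  have h := congrArg (Complex.I * ·) S.equilibrium_im
  simp only [mul_zero, Finset.mul_sum, mul_smul_comm] at h
  rw [← h]
  refine Finset.sum_congr rfl fun c _ => ?_
  rw [diff_eq, W, nor, mul_neg, mul_smul_comm, smul_neg, smul_smul, ← neg_smul]
  congr 1
  simp
  ring

theorem le_norm_sub (i j : ι) (z z' : ℤ × ℤ) (h : ¬(j = i ∧ z' = z)) :
    S.r i + S.r j ≤ ‖S.P i + S.lam z - (S.P j + S.lam z')‖ := by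
  have := S.pack i j (z - z') (fun h' => h ⟨h'.1, (sub_eq_zero.1 h'.2).symm⟩)
  convert this using 2
  change _ = _ + S.lam (z - z')
  rw [lam_sub]
  ring

theorem two_mul_r_le (i : ι) (z : ℤ × ℤ) (h : z ≠ 0) : 2 * S.r i ≤ ‖S.lam z‖ := by
  have := S.le_norm_sub i i z 0 (fun h' => h h'.2.symm)
  rw [lam_zero] at this
  simp at this
  linarith

theorem eq_of_u_eq {c c' : C} (hs : S.s c = S.s c') (hu : S.u c = S.u c') : c = c' := by
  have h : S.s (S.rev c) = S.s (S.rev c') ∧ S.l c = S.l c' := by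
    by_contra h
    have h1 := S.le_norm_sub (S.s (S.rev c')) (S.s (S.rev c)) (-S.l c') (-S.l c) fun h' =>
      h ⟨h'.1, neg_injective h'.2⟩
    have e : S.P (S.s (S.rev c')) + S.lam (-S.l c') - (S.P (S.s (S.rev c)) + S.lam (-S.l c)) =
        (S.L c' - S.L c) • S.u c := by
      rw [sub_smul, S.smul_L_u c, hu, S.smul_L_u c', lam_neg, lam_neg, hs]
      ring
    rw [e, norm_smul, norm_u, mul_one, Real.norm_eq_abs, L, L, hs, add_sub_add_left_eq_sub] at h1
    have := S.r_pos (S.s (S.rev c'))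
    have := S.r_pos (S.s (S.rev c))
    rcases abs_cases (S.r (S.s (S.rev c')) - S.r (S.s (S.rev c))) with h | h <;> linarith
  exact S.contact_ext c c' hs h.1 h.2

end StressedPacking

/-- A smooth cutoff, equal to `1` near zero and vanishing outside of `[-ε, ε]`. -/
def cutoff (ε t : ℝ) : ℝ := Real.smoothTransition (2 - 2 * t ^ 2 / ε ^ 2)

theorem cutoff_nonneg (ε t : ℝ) : 0 ≤ cutoff ε t := Real.smoothTransition.nonneg _

theorem cutoff_le_one (ε t : ℝ) : cutoff ε t ≤ 1 := Real.smoothTransition.le_one _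

theorem cutoff_eq_zero {ε t : ℝ} (hε : 0 < ε) (ht : ε ≤ t) : cutoff ε t = 0 := by
  apply Real.smoothTransition.zero_of_nonpos
  have : 2 ≤ 2 * t ^ 2 / ε ^ 2 := by
    rw [le_div_iff₀ (by positivity)]
    nlinarith
  linarith

theorem cutoff_eq_one {ε t : ℝ} (hε : 0 < ε) (h0 : 0 ≤ t) (ht : t ≤ ε / 2) :
    cutoff ε t = 1 := by
  apply Real.smoothTransition.one_of_one_le
  have : 2 * t ^ 2 / ε ^ 2 ≤ 1 := by
    rw [div_le_one (by positivity)]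
    nlinarith
  linarith

theorem contDiff_cutoff_norm (ε : ℝ) (v : ℂ) :
    ContDiff ℝ 1 fun x : ℂ => cutoff ε ‖x - v‖ := by
  unfold cutoff
  refine Real.smoothTransition.contDiff.comp ?_
  exact contDiff_const.sub ((contDiff_const.mul
    ((contDiff_id.sub contDiff_const).norm_sq ℝ)).div_const _)

theorem continuous_cutoff (ε : ℝ) : Continuous (cutoff ε) :=
  Real.smoothTransition.continuous.comp (by fun_prop)

theorem rectVec_add (b₁ b₂ : ℝ) (z z' : ℤ × ℤ) :
    rectVec b₁ b₂ (z + z') = rectVec b₁ b₂ z + rectVec b₁ b₂ z' := by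
  apply Complex.ext <;> simp [rectVec, add_mul]

/-- A smooth approximate identity, periodic with respect to a rectangular lattice. -/
def mollifier (b₁ b₂ ε : ℝ) (x : ℂ) : ℝ := ∑ᶠ z, cutoff ε ‖x - rectVec b₁ b₂ z‖

section Mollifier

variable {b₁ b₂ ε : ℝ}

theorem mollifier_add (x : ℂ) (z : ℤ × ℤ) :
    mollifier b₁ b₂ ε (x + rectVec b₁ b₂ z) = mollifier b₁ b₂ ε x := by
  rw [mollifier, ← finsum_comp_equiv (Equiv.addRight z), mollifier]
  refine finsum_congr fun z' => ?_
  rw [Equiv.coe_addRight, rectVec_add, add_sub_add_right_eq_sub]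

theorem mollifier_sub (x : ℂ) (z : ℤ × ℤ) :
    mollifier b₁ b₂ ε (x - rectVec b₁ b₂ z) = mollifier b₁ b₂ ε x := by
  rw [← mollifier_add (x - _) z, sub_add_cancel]

theorem exists_of_mollifier_ne_zero (hε : 0 < ε) {x : ℂ} (h : mollifier b₁ b₂ ε x ≠ 0) :
    ∃ z, ‖x - rectVec b₁ b₂ z‖ < ε := by
  obtain ⟨z, hz⟩ : ∃ z, cutoff ε ‖x - rectVec b₁ b₂ z‖ ≠ 0 := by
    by_contra! h0
    exact h (by simp [mollifier, h0])
  refine ⟨z, ?_⟩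
  by_contra! h
  exact hz (cutoff_eq_zero hε h)

theorem mollifier_eq_zero (hε : 0 < ε) {x : ℂ} (h : ∀ z, ε ≤ ‖x - rectVec b₁ b₂ z‖) :
    mollifier b₁ b₂ ε x = 0 := by
  by_contra h'
  obtain ⟨z, hz⟩ := exists_of_mollifier_ne_zero hε h'
  exact absurd (h z) hz.not_ge

theorem mollifier_nonneg (x : ℂ) : 0 ≤ mollifier b₁ b₂ ε x :=
  finsum_nonneg fun _ => cutoff_nonneg _ _

theorem mollifier_eq (hε : 0 < ε) {x : ℂ} (h : ∀ z, z ≠ 0 → ‖x‖ + ε ≤ ‖rectVec b₁ b₂ z‖) :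
    mollifier b₁ b₂ ε x = cutoff ε ‖x‖ := by
  rw [mollifier, finsum_eq_single _ (0 : ℤ × ℤ)]
  · simp [rectVec]
    rw [show (⟨0, 0⟩ : ℂ) = 0 from rfl, sub_zero]
  · intro z hz
    apply cutoff_eq_zero hε
    have := h z hz
    have h2 := norm_sub_norm_le (rectVec b₁ b₂ z) x
    rw [norm_sub_rev] at h2
    linarith

theorem rectVec_sub (b₁ b₂ : ℝ) (z z' : ℤ × ℤ) :
    rectVec b₁ b₂ (z - z') = rectVec b₁ b₂ z - rectVec b₁ b₂ z' := by
  rw [sub_eq_add_neg, rectVec_add, rectVec_neg, sub_eq_add_neg]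

theorem eq_of_norm_sub_lt (h : ∀ z, z ≠ 0 → 3 * ε ≤ ‖rectVec b₁ b₂ z‖) {z z' : ℤ × ℤ}
    (hz : ‖rectVec b₁ b₂ z - rectVec b₁ b₂ z'‖ < 3 * ε) : z = z' := by
  by_contra hne
  have := h (z - z') (sub_ne_zero.2 hne)
  rw [rectVec_sub] at this
  linarith

theorem contDiff_mollifier (hε : 0 < ε) (h : ∀ z, z ≠ 0 → 3 * ε ≤ ‖rectVec b₁ b₂ z‖) :
    ContDiff ℝ 1 (mollifier b₁ b₂ ε) := by
  rw [← contMDiff_iff_contDiff]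
  refine contMDiff_finsum (fun z => (contDiff_cutoff_norm ε (rectVec b₁ b₂ z)).contMDiff) ?_
  intro x
  refine ⟨Metric.ball x (ε / 2), Metric.ball_mem_nhds _ (by positivity),
    Set.Subsingleton.finite ?_⟩
  have key : ∀ z, ((Function.support fun y => cutoff ε ‖y - rectVec b₁ b₂ z‖) ∩
      Metric.ball x (ε / 2)).Nonempty → ‖x - rectVec b₁ b₂ z‖ < 3 / 2 * ε := by
    rintro z ⟨y, hy, hyx⟩
    have h1 : ‖y - rectVec b₁ b₂ z‖ < ε := by
      by_contra! h
      exact hy (cutoff_eq_zero hε h)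
    rw [mem_ball_iff_norm] at hyx
    have := norm_sub_le_norm_sub_add_norm_sub x y (rectVec b₁ b₂ z)
    rw [norm_sub_rev x y] at this
    linarith
  intro z hz z' hz'
  apply eq_of_norm_sub_lt h
  have := norm_sub_le_norm_sub_add_norm_sub (rectVec b₁ b₂ z) x (rectVec b₁ b₂ z')
  rw [norm_sub_rev _ x] at this
  linarith [key z hz, key z' hz']

end Mollifier

/-- The integral of `η` along the segment from `x` to `x - r • u`. -/
def segInt (η : ℂ → ℝ) (u : ℂ) (r : ℝ) (x : ℂ) : ℝ := ∫ τ in 0..r, η (x - (τ : ℝ) • u)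

theorem hasFDerivAt_segInt {η : ℂ → ℝ} (hη : ContDiff ℝ 1 η) (u : ℂ) (r : ℝ) (x : ℂ) :
    HasFDerivAt (segInt η u r) (∫ τ in 0..r, fderiv ℝ η (x - (τ : ℝ) • u)) x := by
  have hc : Continuous (fderiv ℝ η) := hη.continuous_fderiv one_ne_zero
  have hηc := hη.continuous
  have hcc : Continuous fun p : ℂ × ℝ => fderiv ℝ η (p.1 - p.2 • u) := by fun_prop
  obtain ⟨B, hB⟩ := ((isCompact_closedBall x 1).prod (isCompact_uIcc (a := (0 : ℝ)) (b := r))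
    ).exists_bound_of_continuousOn hcc.continuousOn
  refine intervalIntegral.hasFDerivAt_integral_of_dominated_of_fderiv_le
    (F := fun x τ => η (x - τ • u)) (F' := fun x τ => fderiv ℝ η (x - τ • u))
    (bound := fun _ => B) (Metric.ball_mem_nhds x one_pos)
    (Filter.Eventually.of_forall fun y => ?_) ?_ ?_ ?_ ?_ ?_
  · exact (by fun_prop : Continuous fun τ : ℝ => η (y - τ • u)).aestronglyMeasurable
  · exact (by fun_prop : Continuous fun τ : ℝ => η (x - τ • u)).intervalIntegrable _ _
  · exact (by fun_prop : Continuous fun τ : ℝ =>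
      fderiv ℝ η (x - τ • u)).aestronglyMeasurable
  · exact Filter.Eventually.of_forall fun t ht y hy =>
      hB (y, t) ⟨Metric.ball_subset_closedBall hy, Set.uIoc_subset_uIcc ht⟩
  · exact intervalIntegrable_const
  · refine Filter.Eventually.of_forall fun t _ y _ => ?_
    have := (hη.differentiable one_ne_zero (y - t • u)).hasFDerivAt
    exact this.comp y ((hasFDerivAt_id y).sub_const _)

theorem fderiv_segInt_apply {η : ℂ → ℝ} (hη : ContDiff ℝ 1 η) (u : ℂ) (r : ℝ) (x : ℂ) :
    fderiv ℝ (segInt η u r) x u = η x - η (x - r • u) := by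
  have hc : Continuous (fderiv ℝ η) := hη.continuous_fderiv one_ne_zero
  rw [(hasFDerivAt_segInt hη u r x).fderiv, ContinuousLinearMap.intervalIntegral_apply
    ((by fun_prop : Continuous fun τ : ℝ => fderiv ℝ η (x - τ • u)).intervalIntegrable _ _)]
  have h := intervalIntegral.integral_eq_sub_of_hasDerivAt (a := 0) (b := r)
    (f := fun τ : ℝ => -η (x - τ • u)) (f' := fun τ : ℝ => fderiv ℝ η (x - τ • u) u)
    (fun τ _ => ?_)
    ((by fun_prop : Continuous fun τ : ℝ => fderiv ℝ η (x - τ • u) u).intervalIntegrable _ _)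
  · rw [h]
    simp
    ring
  · have h1 := (hη.differentiable one_ne_zero (x - τ • u)).hasFDerivAt
    have h2 : HasDerivAt (fun τ : ℝ => x - τ • u) (-u) τ := by
      simpa using ((hasDerivAt_id τ).smul_const u).const_sub x
    have h3 := (h1.comp_hasDerivAt τ h2).neg
    rw [map_neg, neg_neg] at h3
    exact h3

theorem differentiable_segInt {η : ℂ → ℝ} (hη : ContDiff ℝ 1 η) (u : ℂ) (r : ℝ) :
    Differentiable ℝ (segInt η u r) :=
  fun x => (hasFDerivAt_segInt hη u r x).differentiableAt

/-- The integral over the period cell of a rectangular lattice. -/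
def cellInt {E : Type} [NormedAddCommGroup E] [NormedSpace ℝ E] (b₁ b₂ : ℝ) (F : ℂ → E) : E :=
  ∫ s in 0..b₁, ∫ t in 0..b₂, F ⟨s, t⟩

section CellInt

variable {E : Type} [NormedAddCommGroup E] [NormedSpace ℝ E] {b₁ b₂ : ℝ} {F : ℂ → E}

theorem continuous_mk {X : Type} [TopologicalSpace X] {f g : X → ℝ} (hf : Continuous f)
    (hg : Continuous g) : Continuous fun x => (⟨f x, g x⟩ : ℂ) := by
  change Continuous fun x => Complex.equivRealProdCLM.symm (f x, g x)
  fun_prop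

theorem cellInt_add_left (hp : ∀ x z, F (x + rectVec b₁ b₂ z) = F x) (v : ℂ) :
    cellInt b₁ b₂ (fun x => F (x + v)) = cellInt b₁ b₂ F := by
  have h1 : Function.Periodic (fun s : ℝ => ∫ t in 0..b₂, F ⟨s, t⟩) b₁ := fun s => by
    refine intervalIntegral.integral_congr fun t _ => ?_
    rw [← hp ⟨s, t⟩ (1, 0)]
    congr 1
    apply Complex.ext <;> simp [rectVec]
  have h2 : ∀ s, Function.Periodic (fun t : ℝ => F ⟨s, t⟩) b₂ := fun s t => by
    beta_reduce
    rw [← hp ⟨s, t⟩ (0, 1)]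
    congr 1
    apply Complex.ext <;> simp [rectVec]
  have h3 : ∀ s, (∫ t in 0..b₂, F (⟨s, t⟩ + v)) = ∫ t in 0..b₂, F ⟨s + v.re, t⟩ := fun s => by
    have := (h2 (s + v.re)).intervalIntegral_add_eq v.im 0
    rw [zero_add] at this
    rw [← this, add_comm v.im b₂]
    have h := intervalIntegral.integral_comp_add_right (a := 0) (b := b₂)
      (fun t => F ⟨s + v.re, t⟩) v.im
    rw [zero_add] at h
    rw [← h]
    rfl
  rw [cellInt, intervalIntegral.integral_congr fun s _ => h3 s, cellInt]
  have h := intervalIntegral.integral_comp_add_right (a := 0) (b := b₁)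
      (fun s => ∫ t in 0..b₂, F ⟨s, t⟩) v.re
  rw [h, zero_add]
  have := h1.intervalIntegral_add_eq v.re 0
  rw [zero_add, add_comm] at this
  exact this

theorem integrableOn_uIoc_prod {G : Type*} [NormedAddCommGroup G] {f : ℝ × ℝ → G} (hf : Continuous f) (a b c d : ℝ) :
    MeasureTheory.IntegrableOn f (Set.uIoc a b ×ˢ Set.uIoc c d) :=
  (hf.continuousOn.integrableOn_compact (isCompact_uIcc.prod isCompact_uIcc)).mono_set
    (Set.prod_mono Set.uIoc_subset_uIcc Set.uIoc_subset_uIcc)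

theorem cellInt_integral [CompleteSpace E] (hF : Continuous F)
    (hp : ∀ x z, F (x + rectVec b₁ b₂ z) = F x)
    {γ : ℝ → ℂ} (hγ : Continuous γ) (r : ℝ) :
    cellInt b₁ b₂ (fun x => ∫ τ in 0..r, F (x + γ τ)) = r • cellInt b₁ b₂ F := by
  have h1 : ∀ s : ℝ, (∫ t in 0..b₂, ∫ τ in 0..r, F (⟨s, t⟩ + γ τ)) =
      ∫ τ in 0..r, ∫ t in 0..b₂, F (⟨s, t⟩ + γ τ) := fun s => by
    refine MeasureTheory.intervalIntegral_intervalIntegral_swap ?_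
    refine integrableOn_uIoc_prod ?_ _ _ _ _
    exact hF.comp ((continuous_mk (by fun_prop) (by fun_prop)).add (by fun_prop))
  have h2 : Continuous fun p : ℝ × ℝ => ∫ t in 0..b₂, F (⟨p.1, t⟩ + γ p.2) := by
    apply intervalIntegral.continuous_parametric_intervalIntegral_of_continuous'
    exact hF.comp ((continuous_mk (by fun_prop) (by fun_prop)).add (by fun_prop))
  rw [cellInt, intervalIntegral.integral_congr fun s _ => h1 s,
    MeasureTheory.intervalIntegral_intervalIntegral_swap]
  · have : ∀ τ, (∫ s in 0..b₁, ∫ t in 0..b₂, F (⟨s, t⟩ + γ τ)) = cellInt b₁ b₂ F :=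
      fun τ => cellInt_add_left hp (γ τ)
    simp only [this, intervalIntegral.integral_const, sub_zero]
  · exact integrableOn_uIoc_prod h2 _ _ _ _

theorem cellInt_sum_smul [CompleteSpace E] {C : Type} [Fintype C] {f : C → ℂ → ℝ}
    (hf : ∀ c, Continuous (f c))
    (e : C → E) :
    cellInt b₁ b₂ (fun x => ∑ c, f c x • e c) = ∑ c, cellInt b₁ b₂ (f c) • e c := by
  have h1 : ∀ (c : C) (s : ℝ), Continuous fun t : ℝ => f c ⟨s, t⟩ := fun c s =>
    (hf c).comp (continuous_mk (by fun_prop) (by fun_prop))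
  have h2 : ∀ c : C, Continuous fun s : ℝ => ∫ t in 0..b₂, f c ⟨s, t⟩ := fun c => by
    apply intervalIntegral.continuous_parametric_intervalIntegral_of_continuous'
    exact (hf c).comp (continuous_mk (by fun_prop) (by fun_prop))
  have h3 : ∀ (c : C) (s : ℝ), Continuous fun t : ℝ => f c ⟨s, t⟩ • e c := fun c s =>
    (h1 c s).smul continuous_const
  have h4 : ∀ c : C, Continuous fun s : ℝ => (∫ t in 0..b₂, f c ⟨s, t⟩) • e c := fun c =>
    (h2 c).smul continuous_const
  have h5 : ∀ s : ℝ, (∫ t in 0..b₂, ∑ c, f c ⟨s, t⟩ • e c) =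
      ∑ c, (∫ t in 0..b₂, f c ⟨s, t⟩) • e c := fun s => by
    rw [intervalIntegral.integral_finsetSum fun c _ => (h3 c s).intervalIntegrable _ _]
    simp only [intervalIntegral.integral_smul_const]
  rw [cellInt, intervalIntegral.integral_congr fun s _ => h5 s,
    intervalIntegral.integral_finsetSum fun c _ => (h4 c).intervalIntegrable _ _]
  simp only [intervalIntegral.integral_smul_const, cellInt]

theorem cellInt_const (k : E) [CompleteSpace E] :
    cellInt b₁ b₂ (fun _ => k) = (b₁ * b₂) • k := by
  simp [cellInt, smul_smul, mul_comm]

end CellInt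

/-- The real inner product of two complex numbers, as a bilinear map. -/
def dotL : ℂ →L[ℝ] ℂ →L[ℝ] ℝ :=
  Complex.reCLM.smulRight Complex.reCLM + Complex.imCLM.smulRight Complex.imCLM

theorem dotL_apply (v x : ℂ) : dotL v x = dot v x := by
  simp [dotL, dot]

namespace StressedPacking

variable {ι C : Type} [Fintype C] (S : StressedPacking ι C) (ε : ℝ)

/-- The mollified indicator function of the half-edges of the contact graph which correspond
to the contact `c`. -/
def halfEdge (c : C) (x : ℂ) : ℝ :=
  segInt (mollifier S.b₁ S.b₂ ε) (S.u c) (S.r (S.s c)) (x - S.P (S.s c))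

/-- The mollified stress tensor, turned by a right angle. -/
def tensor (x : ℂ) : ℂ →L[ℝ] ℂ :=
  ∑ c, (S.W c * S.halfEdge ε c x) • (dotL (S.nor c)).smulRight (S.nor c)

theorem tensor_apply (x v : ℂ) :
    S.tensor ε x v = ∑ c, S.halfEdge ε c x • ((S.W c * dot (S.nor c) v) • S.nor c) := by
  simp only [tensor, sum_apply, smul_apply,
    ContinuousLinearMap.smulRight_apply, dotL_apply, smul_smul]
  refine Finset.sum_congr rfl fun c _ => ?_
  ring_nf

theorem halfEdge_add (c : C) (x : ℂ) (z : ℤ × ℤ) :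
    S.halfEdge ε c (x + S.lam z) = S.halfEdge ε c x := by
  unfold halfEdge segInt
  refine intervalIntegral.integral_congr fun τ _ => ?_
  rw [← mollifier_add (x - _ - _) z]
  congr 1
  rw [lam]
  ring

theorem tensor_add (x : ℂ) (z : ℤ × ℤ) : S.tensor ε (x + S.lam z) = S.tensor ε x := by
  simp only [tensor, halfEdge_add]

theorem dot_sub_smul (n a b : ℂ) :
    dot n b • a - dot n a • b = (a.im * b.re - a.re * b.im) • (Complex.I * n) := by
  apply Complex.ext <;> simp [dot] <;> ring

theorem sum_W_smul_tensor (v : ℂ) :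
    ∑ c, S.r (S.s c) • ((S.W c * dot (S.nor c) v) • S.nor c) = 0 := by
  have h : ∑ c, S.L c • ((S.W c * dot (S.nor c) v) • S.nor c) = 0 := by
    have h1 := congrArg (fun x => v.re • x) S.sum_W_L_im
    have h2 := congrArg (fun x => v.im • x) S.sum_W_L_re
    simp only [Finset.smul_sum, smul_zero] at h1 h2
    rw [← sub_zero 0]
    nth_rw 1 [← h2]
    rw [← h1, ← Finset.sum_sub_distrib]
    refine Finset.sum_congr rfl fun c _ => ?_
    rw [smul_smul, smul_smul, smul_smul, ← sub_smul]
    congr 1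
    simp [dot, nor]
    ring
  have h2 := S.sum_rev fun c => S.r (S.s c) • ((S.W c * dot (S.nor c) v) • S.nor c)
  have h3 : ∀ c, S.r (S.s (S.rev c)) • ((S.W (S.rev c) * dot (S.nor (S.rev c)) v) •
      S.nor (S.rev c)) = S.r (S.s (S.rev c)) • ((S.W c * dot (S.nor c) v) • S.nor c) := by
    intro c
    rw [nor_rev, W_rev, smul_smul, smul_smul, smul_neg, ← neg_smul]
    congr 1
    simp [dot]
    ring
  simp only [h3] at h2
  simp only [L, add_smul, Finset.sum_add_distrib, h2] at h
  exact add_self_eq_zero.1 h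

variable {ε}

theorem differentiable_halfEdge (hη : ContDiff ℝ 1 (mollifier S.b₁ S.b₂ ε)) (c : C) :
    Differentiable ℝ (S.halfEdge ε c) :=
  (differentiable_segInt hη _ _).comp (differentiable_id.sub_const _)

theorem fderiv_halfEdge_apply (hη : ContDiff ℝ 1 (mollifier S.b₁ S.b₂ ε)) (c : C) (x : ℂ) :
    fderiv ℝ (S.halfEdge ε c) x (S.u c) = mollifier S.b₁ S.b₂ ε (x - S.P (S.s c)) -
      mollifier S.b₁ S.b₂ ε (x - S.P (S.s c) - S.r (S.s c) • S.u c) := by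
  rw [← fderiv_segInt_apply hη]
  change fderiv ℝ (fun y => segInt _ _ _ (y - S.P (S.s c))) x _ = _
  rw [fderiv_comp_sub]

theorem differentiable_tensor (hη : ContDiff ℝ 1 (mollifier S.b₁ S.b₂ ε)) :
    Differentiable ℝ (S.tensor ε) := by
  unfold tensor
  have := S.differentiable_halfEdge hη
  fun_prop

theorem fderiv_tensor_apply (hη : ContDiff ℝ 1 (mollifier S.b₁ S.b₂ ε)) (x a b : ℂ) :
    fderiv ℝ (S.tensor ε) x a b =
      ∑ c, (S.W c * (fderiv ℝ (S.halfEdge ε c) x (dot (S.nor c) b • a))) • S.nor c := by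
  have h : HasFDerivAt (S.tensor ε) (∑ c, (S.W c • fderiv ℝ (S.halfEdge ε c) x).smulRight
      ((dotL (S.nor c)).smulRight (S.nor c))) x := by
    unfold tensor
    refine HasFDerivAt.fun_sum fun c _ => ?_
    exact ((S.differentiable_halfEdge hη c x).hasFDerivAt.const_mul (S.W c)).smul_const
      ((dotL (S.nor c)).smulRight (S.nor c))
  rw [h.fderiv]
  simp only [sum_apply, smul_apply,
    ContinuousLinearMap.smulRight_apply, dotL_apply, smul_smul, map_smul, smul_eq_mul]
  refine Finset.sum_congr rfl fun c _ => ?_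
  ring_nf

theorem sum_mollifier_contact : ∑ c, (S.W c * mollifier S.b₁ S.b₂ ε
    (x - S.P (S.s c) - S.r (S.s c) • S.u c)) • S.nor c = 0 := by
  have h := S.sum_rev fun c => (S.W c * mollifier S.b₁ S.b₂ ε
    (x - S.P (S.s c) - S.r (S.s c) • S.u c)) • S.nor c
  rw [← add_self_eq_zero]
  nth_rw 1 [← h]
  rw [← Finset.sum_add_distrib]
  refine Finset.sum_eq_zero fun c _ => ?_
  have e : x - S.P (S.s (S.rev c)) - S.r (S.s (S.rev c)) • S.u (S.rev c) =
      x - S.P (S.s c) - S.r (S.s c) • S.u c - rectVec S.b₁ S.b₂ (S.l c) := by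
    have h := S.smul_L_u c
    rw [L, add_smul] at h
    rw [u_rev, smul_neg, eq_sub_of_add_eq' h, lam]
    ring
  rw [W_rev, nor_rev, e, mollifier_sub, smul_neg, neg_add_cancel]

theorem fderiv_tensor_symm (hη : ContDiff ℝ 1 (mollifier S.b₁ S.b₂ ε)) (x a b : ℂ) :
    fderiv ℝ (S.tensor ε) x a b = fderiv ℝ (S.tensor ε) x b a := by
  rw [← sub_eq_zero, fderiv_tensor_apply S hη, fderiv_tensor_apply S hη,
    ← Finset.sum_sub_distrib]
  have h1 := S.sum_W_smul_nor fun i => mollifier S.b₁ S.b₂ ε (x - S.P i)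
  have h2 := congrArg (fun y => (a.re * b.im - a.im * b.re) • y)
    ((congrArg₂ (· - ·) h1 (S.sum_mollifier_contact (x := x) (ε := ε))))
  simp only [sub_zero, smul_zero, ← Finset.sum_sub_distrib, Finset.smul_sum] at h2
  rw [← h2]
  refine Finset.sum_congr rfl fun c _ => ?_
  rw [← sub_smul, ← mul_sub, ← map_sub, dot_sub_smul, ← sub_smul, ← mul_sub,
    ← fderiv_halfEdge_apply S hη, smul_smul]
  congr 1
  have : Complex.I * S.nor c = -S.u c := by
    rw [nor, ← mul_assoc, Complex.I_mul_I, neg_one_mul]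
  rw [this, smul_neg, map_neg, map_smul, smul_eq_mul]
  ring

theorem dot_tensor_comm (x a b : ℂ) :
    dot (S.tensor ε x a) b = dot (S.tensor ε x b) a := by
  rw [← sub_eq_zero]
  simp only [tensor_apply, dot, Complex.re_sum, Complex.im_sum, Finset.sum_mul, ←
    Finset.sum_add_distrib, ← Finset.sum_sub_distrib]
  refine Finset.sum_eq_zero fun c _ => ?_
  simp
  ring
end StressedPacking

namespace StressedPacking

variable {ι C : Type} [Fintype C] (S : StressedPacking ι C) {ε : ℝ}

theorem cellInt_halfEdge (hη : Continuous (mollifier S.b₁ S.b₂ ε)) (c : C) :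
    cellInt S.b₁ S.b₂ (S.halfEdge ε c) =
      S.r (S.s c) * cellInt S.b₁ S.b₂ (mollifier S.b₁ S.b₂ ε) := by
  have h := cellInt_integral hη (fun x z => mollifier_add x z)
    (γ := fun τ : ℝ => -S.P (S.s c) - τ • S.u c) (by fun_prop) (S.r (S.s c))
  rw [smul_eq_mul] at h
  rw [← h]
  congr 1
  funext x
  rw [halfEdge, segInt]
  refine intervalIntegral.integral_congr fun τ _ => ?_
  congr 1
  ring

theorem exists_tensor_primitive (hη : ContDiff ℝ 1 (mollifier S.b₁ S.b₂ ε)) :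
    ∃ g : ℂ → ℂ, (∀ x, HasFDerivAt g (S.tensor ε x) x) ∧ ∀ x z, g (x + S.lam z) = g x := by
  have hQ := S.differentiable_tensor hη
  obtain ⟨g, hg⟩ := convex_univ.exists_forall_hasFDerivAt_of_fderiv_symmetric isOpen_univ
    hQ.differentiableOn (fun x _ a b => S.fderiv_tensor_symm hη x a b)
  replace hg : ∀ x, HasFDerivAt g (S.tensor ε x) x := fun x => hg x trivial
  refine ⟨g, hg, fun x z => ?_⟩
  have hd : ∀ x, HasFDerivAt (fun x => g (x + S.lam z) - g x) (0 : ℂ →L[ℝ] ℂ) x := fun x => by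
    have h1 := (hg (x + S.lam z)).comp x ((hasFDerivAt_id x).add_const (S.lam z))
    rw [tensor_add, ContinuousLinearMap.comp_id] at h1
    have h2 := h1.sub (hg x)
    rw [sub_self] at h2
    exact h2
  have hconst : ∀ y, g (y + S.lam z) - g y = g (x + S.lam z) - g x := fun y =>
    is_const_of_fderiv_eq_zero (𝕜 := ℝ) (fun x => (hd x).differentiableAt)
      (fun x => (hd x).fderiv) y x
  have hinc : ∀ y, (∫ t in (0 : ℝ)..1, S.tensor ε (y + t • S.lam z) (S.lam z)) =
      g (x + S.lam z) - g x := fun y => by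
    rw [← hconst y, intervalIntegral.integral_eq_sub_of_hasDerivAt
      (f := fun t : ℝ => g (y + t • S.lam z))]
    · simp
    · intro t _
      have h2 : HasDerivAt (fun t : ℝ => y + t • S.lam z) (S.lam z) t := by
        simpa using ((hasDerivAt_id t).smul_const (S.lam z)).const_add y
      exact (hg _).comp_hasDerivAt t h2
    · refine Continuous.intervalIntegrable ?_ _ _
      have := hQ.continuous
      fun_prop
  have hzero : cellInt S.b₁ S.b₂ (fun y => S.tensor ε y (S.lam z)) = 0 := by
    simp only [tensor_apply]
    rw [cellInt_sum_smul fun c => (S.differentiable_halfEdge hη c).continuous]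
    simp only [S.cellInt_halfEdge hη.continuous]
    have h := congrArg (fun x => cellInt S.b₁ S.b₂ (mollifier S.b₁ S.b₂ ε) • x)
      (S.sum_W_smul_tensor (S.lam z))
    simp only [Finset.smul_sum, smul_zero] at h
    rw [← h]
    refine Finset.sum_congr rfl fun c _ => ?_
    simp only [smul_smul]
    ring_nf
  have h := cellInt_integral (b₁ := S.b₁) (b₂ := S.b₂)
    (F := fun y => S.tensor ε y (S.lam z)) (by have := hQ.continuous; fun_prop)
    (fun y z' => congrArg (fun T => T (S.lam z)) (S.tensor_add ε y z'))
    (γ := fun t : ℝ => t • S.lam z) (by fun_prop) 1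
  simp only [hinc, hzero, smul_zero, cellInt_const] at h
  have := S.b₁_pos
  have := S.b₂_pos
  have h' := (smul_eq_zero.1 h).resolve_left (by positivity)
  exact sub_eq_zero.1 h'

theorem lam_eq (z : ℤ × ℤ) : S.lam z = z.1 • S.lam (1, 0) + z.2 • S.lam (0, 1) := by
  apply Complex.ext <;> simp [lam, rectVec]

theorem exists_potential (hη : ContDiff ℝ 1 (mollifier S.b₁ S.b₂ ε)) :
    ∃ (φ : ℂ → ℝ) (g : ℂ → ℂ), (∀ x, HasFDerivAt φ (dotL (g x)) x) ∧
      (∀ x, HasFDerivAt g (S.tensor ε x) x) ∧ ∀ x z, φ (x + S.lam z) = φ x := by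
  obtain ⟨g, hg, hgp⟩ := S.exists_tensor_primitive hη
  have hd : ∀ x, HasFDerivAt (fun x => dotL (g x)) (dotL ∘L S.tensor ε x) x := fun x =>
    dotL.hasFDerivAt.comp x (hg x)
  obtain ⟨φ, hφ⟩ := convex_univ.exists_forall_hasFDerivAt_of_fderiv_symmetric isOpen_univ
    (ω := fun x => dotL (g x)) (fun x _ => (hd x).differentiableAt.differentiableWithinAt)
    (fun x _ a b => by
      rw [(hd x).fderiv]
      simp only [ContinuousLinearMap.comp_apply, dotL_apply]
      exact S.dot_tensor_comm x a b)
  replace hφ : ∀ x, HasFDerivAt φ (dotL (g x)) x := fun x => hφ x trivial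
  have hconst : ∀ z x, φ (x + S.lam z) - φ x = φ (0 + S.lam z) - φ 0 := fun z x => by
    have hd : ∀ x, HasFDerivAt (fun x => φ (x + S.lam z) - φ x) (0 : ℂ →L[ℝ] ℝ) x := fun x => by
      have h1 := (hφ (x + S.lam z)).comp x ((hasFDerivAt_id x).add_const (S.lam z))
      rw [hgp, ContinuousLinearMap.comp_id] at h1
      have h2 := h1.sub (hφ x)
      rw [sub_self] at h2
      exact h2
    exact is_const_of_fderiv_eq_zero (𝕜 := ℝ) (fun x => (hd x).differentiableAt)
      (fun x => (hd x).fderiv) x 0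
  have hb₁ := S.b₁_pos.ne'
  have hb₂ := S.b₂_pos.ne'
  obtain ⟨a, ha⟩ : ∃ a : ℂ, ∀ z : ℤ × ℤ, (z = (1, 0) ∨ z = (0, 1)) →
      dotL a (S.lam z) = φ (0 + S.lam z) - φ 0 := by
    refine ⟨⟨(φ (0 + S.lam (1, 0)) - φ 0) / S.b₁, (φ (0 + S.lam (0, 1)) - φ 0) / S.b₂⟩, ?_⟩
    rintro z (rfl | rfl) <;> rw [dotL_apply] <;> simp only [dot] <;> simp [lam, rectVec] <;>
      field_simp
  have hper : ∀ z : ℤ × ℤ, (z = (1, 0) ∨ z = (0, 1)) →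
      Function.Periodic (fun x => φ x - dotL a x) (S.lam z) := fun z hz x => by
    beta_reduce
    rw [map_add, ha z hz, ← hconst z x]
    ring
  refine ⟨fun x => φ x - dotL a x, fun x => g x - a, fun x => ?_, fun x => (hg x).sub_const a,
    fun x z => ?_⟩
  · rw [map_sub]
    exact (hφ x).sub (dotL a).hasFDerivAt
  · rw [lam_eq, ← add_assoc]
    exact ((hper _ (Or.inr rfl)).zsmul z.2 _).trans ((hper _ (Or.inl rfl)).zsmul z.1 x)

end StressedPacking

theorem norm_smul_sub_smul_sq {u v : ℂ} (hu : ‖u‖ = 1) (hv : ‖v‖ = 1) (a b : ℝ) :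
    ‖a • u - b • v‖ ^ 2 = (a + b) ^ 2 - a * b * ‖u + v‖ ^ 2 := by
  rw [norm_sub_sq_real, norm_add_sq_real, norm_smul, norm_smul, hu, hv, real_inner_smul_left,
    real_inner_smul_right, mul_pow, mul_pow, Real.norm_eq_abs, Real.norm_eq_abs, sq_abs, sq_abs]
  ring

theorem smul_norm_sub_le {u v : ℂ} (hv : ‖v‖ = 1) (hu : ‖u‖ = 1) {a b : ℝ} (ha : 0 ≤ a)
    (hb : 0 ≤ b) : a * ‖u - v‖ ≤ 2 * ‖a • u - b • v‖ := by
  have h1 := abs_norm_sub_norm_le (a • u) (b • v)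
  rw [norm_smul, norm_smul, hu, hv, mul_one, mul_one, Real.norm_of_nonneg ha,
    Real.norm_of_nonneg hb] at h1
  have h2 : a • (u - v) = (a • u - b • v) - (a - b) • v := by
    rw [smul_sub, sub_smul]
    abel
  have h3 := norm_sub_le (a • u - b • v) ((a - b) • v)
  rw [← h2, norm_smul, norm_smul, hv, mul_one, Real.norm_of_nonneg ha, Real.norm_eq_abs] at h3
  linarith

namespace StressedPacking

variable {ι C : Type} [Fintype C] (S : StressedPacking ι C)

/-- The point at distance `τ` from the center of a disk on a half-edge of the contact graph. -/
def edgePoint (c : C) (z : ℤ × ℤ) (τ : ℝ) : ℂ := S.P (S.s c) + S.lam z + τ • S.u c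

/-- Lower bounds `κ`, `ρ` for the angles and radii of a packing, and a number `ε` which is small
compared to them. -/
structure Scale (κ ρ ε : ℝ) : Prop where
  κ_pos : 0 < κ
  κ_le_one : κ ≤ 1
  κ_le : ∀ c c', S.u c ≠ S.u c' → κ ≤ ‖S.u c - S.u c'‖
  ρ_pos : 0 < ρ
  ρ_le : ∀ c, ρ ≤ S.r (S.s c)
  ε_pos : 0 < ε
  ε_le : 8 * ε ≤ ρ
  ε_lt : 32 * ε < ρ * κ ^ 2

variable {S} {κ ρ ε : ℝ}

theorem Scale.three_mul_le (h : S.Scale κ ρ ε) (c : C) (z : ℤ × ℤ) (hz : z ≠ 0) :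
    3 * ε ≤ ‖rectVec S.b₁ S.b₂ z‖ := by
  have := S.two_mul_r_le (S.s c) z hz
  have := h.ρ_le c
  have := h.ε_le
  have := h.ε_pos
  rw [lam] at *
  linarith

theorem norm_edgePoint_sub (c : C) (z : ℤ × ℤ) {τ : ℝ} (hτ : 0 ≤ τ) :
    ‖S.edgePoint c z τ - (S.P (S.s c) + S.lam z)‖ = τ := by
  rw [edgePoint, add_sub_cancel_left, norm_smul, norm_u, mul_one, Real.norm_of_nonneg hτ]

theorem Scale.parallel_or_near (h : S.Scale κ ρ ε) {c c' : C} {z z' : ℤ × ℤ} {τ τ' : ℝ} {x : ℂ}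
    (h0 : 0 ≤ τ) (h1 : τ ≤ S.r (S.s c)) (hx : ‖x - S.edgePoint c z τ‖ < 2 * ε)
    (h0' : 0 ≤ τ') (h1' : τ' ≤ S.r (S.s c')) (hx' : ‖x - S.edgePoint c' z' τ'‖ < 2 * ε) :
    S.u c' = S.u c ∨ S.u c' = -S.u c ∨
      ‖x - (S.P (S.s c) + S.lam z)‖ < (2 + 8 / κ) * ε := by
  have hκ := h.κ_pos
  have hε := h.ε_pos
  by_contra! hne
  obtain ⟨hne1, hne2, hfar⟩ := hne
  have hd : ‖S.edgePoint c z τ - S.edgePoint c' z' τ'‖ < 4 * ε := by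
    have := norm_sub_le_norm_sub_add_norm_sub (S.edgePoint c z τ) x (S.edgePoint c' z' τ')
    rw [norm_sub_rev _ x] at this
    linarith
  by_cases hs : S.s c' = S.s c ∧ z' = z
  · have e : S.edgePoint c z τ - S.edgePoint c' z' τ' = τ • S.u c - τ' • S.u c' := by
      rw [edgePoint, edgePoint, hs.1, hs.2]
      abel
    rw [e] at hd
    have h2 := smul_norm_sub_le (S.norm_u c') (S.norm_u c) h0 h0'
    have h3 := mul_le_mul_of_nonneg_left (h.κ_le c c' hne1.symm) h0
    have h4 : τ ≤ 8 / κ * ε := by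
      rw [div_mul_eq_mul_div, le_div_iff₀ hκ]
      linarith
    have h5 := norm_sub_le_norm_sub_add_norm_sub x (S.edgePoint c z τ) (S.P (S.s c) + S.lam z)
    rw [norm_edgePoint_sub _ _ h0] at h5
    linarith
  · have h2 := S.le_norm_sub (S.s c) (S.s c') z z' hs
    set D := ‖τ • S.u c - τ' • S.u c'‖ with hD
    have h3 : ‖S.P (S.s c) + S.lam z - (S.P (S.s c') + S.lam z')‖ ≤
        ‖S.edgePoint c z τ - S.edgePoint c' z' τ'‖ + D := by
      have e : S.P (S.s c) + S.lam z - (S.P (S.s c') + S.lam z') =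
          S.edgePoint c z τ - S.edgePoint c' z' τ' - (τ • S.u c - τ' • S.u c') := by
        simp only [edgePoint]
        abel
      rw [e]
      exact norm_sub_le _ _
    have h4 : D ≤ τ + τ' := by
      have := norm_sub_le (τ • S.u c) (τ' • S.u c')
      rwa [norm_smul, norm_smul, norm_u, norm_u, mul_one, mul_one, Real.norm_of_nonneg h0,
        Real.norm_of_nonneg h0'] at this
    have h5 : κ ≤ ‖S.u c + S.u c'‖ := by
      have := h.κ_le c (S.rev c')
      rw [u_rev, sub_neg_eq_add] at this
      exact this fun h => hne2 (by rw [h, neg_neg])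
    have h6 := norm_smul_sub_smul_sq (S.norm_u c) (S.norm_u c') τ τ'
    rw [← hD] at h6
    have h7 : κ ^ 2 ≤ ‖S.u c + S.u c'‖ ^ 2 := pow_le_pow_left₀ hκ.le h5 2
    have h8 := mul_le_mul_of_nonneg_left h7 (mul_nonneg h0 h0')
    have hρ := h.ρ_le c
    have hρ' := h.ρ_le c'
    have hε' := h.ε_le
    have hlow : ρ / 2 ≤ τ := by linarith
    have hlow' : ρ / 2 ≤ τ' := by linarith
    have h9 : (τ + τ' - 4 * ε) ^ 2 ≤ D ^ 2 := pow_le_pow_left₀ (by linarith) (by linarith) 2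
    have h10 : τ * τ' * κ ^ 2 ≤ 8 * ε * (τ + τ') := by nlinarith
    have h11 : ∀ a b : ℝ, ρ / 2 ≤ a → a ≤ b → a * b * κ ^ 2 ≤ 8 * ε * (a + b) → False := by
      intro a b ha hab h
      have hb : 0 < b := by linarith [‹S.Scale κ ρ ε›.ρ_pos]
      have h1 : b * (a * κ ^ 2) ≤ b * (16 * ε) := by nlinarith
      have h2 := le_of_mul_le_mul_left h1 hb
      have h3 := mul_le_mul_of_nonneg_right ha (sq_nonneg κ)
      linarith [‹S.Scale κ ρ ε›.ε_lt]
    rcases le_total τ τ' with hle | hle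
    · exact h11 τ τ' hlow hle h10
    · exact h11 τ' τ hlow' hle (by linarith)

theorem exists_edgePoint_of_halfEdge_ne_zero (hε : 0 < ε) {c : C} {x : ℂ}
    (hx : S.halfEdge ε c x ≠ 0) :
    ∃ z τ, 0 ≤ τ ∧ τ ≤ S.r (S.s c) ∧ ‖x - S.edgePoint c z τ‖ < ε := by
  by_contra! h
  refine hx ?_
  rw [halfEdge, segInt, intervalIntegral.integral_congr (g := fun _ => 0)]
  · simp
  · intro τ hτ
    rw [Set.uIcc_of_le (S.r_pos _).le] at hτ
    refine mollifier_eq_zero hε fun z => ?_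
    have e : x - S.P (S.s c) - τ • S.u c - rectVec S.b₁ S.b₂ z = x - S.edgePoint c z τ := by
      simp only [edgePoint, lam]
      ring
    rw [e]
    exact h z τ hτ.1 hτ.2

end StressedPacking

theorem taylor_one {f f' f'' : ℝ → ℝ} (hf : ∀ t, HasDerivAt f (f' t) t)
    (hf' : ∀ t, HasDerivAt f' (f'' t) t) (hc : Continuous f'') :
    f 1 = f 0 + f' 0 + ∫ t in (0 : ℝ)..1, (1 - t) * f'' t := by
  have h := intervalIntegral.integral_eq_sub_of_hasDerivAt (a := 0) (b := 1)
    (f := fun t => (1 - t) * f' t + f t) (f' := fun t => (1 - t) * f'' t) (fun t _ => ?_)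
    ((by fun_prop : Continuous fun t => (1 - t) * f'' t).intervalIntegrable _ _)
  · rw [h]
    ring
  · have h1 := (((hasDerivAt_id t).const_sub 1).mul (hf' t)).add (hf t)
    refine h1.congr_deriv ?_
    simp

namespace StressedPacking

variable {ι C : Type} [Fintype C] (S : StressedPacking ι C)

/-- The second derivative of a potential of the mollified stress. -/
def curvature (ε : ℝ) (v x : ℂ) : ℝ := ∑ c, S.W c * dot (S.nor c) v ^ 2 * S.halfEdge ε c x

/-- A periodic function whose Hessian is the mollified stress, turned by a right angle. -/
structure Potential (ε : ℝ) where
  φ : ℂ → ℝ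
  g : ℂ → ℂ
  contDiff : ContDiff ℝ 1 (mollifier S.b₁ S.b₂ ε)
  hasFDerivAt_φ : ∀ x, HasFDerivAt φ (dotL (g x)) x
  hasFDerivAt_g : ∀ x, HasFDerivAt g (S.tensor ε x) x
  φ_add : ∀ x z, φ (x + S.lam z) = φ x

variable {S} {κ ρ ε : ℝ}

theorem Scale.nonempty_potential (h : S.Scale κ ρ ε) (c : C) : Nonempty (S.Potential ε) := by
  have hη := contDiff_mollifier h.ε_pos (h.three_mul_le c)
  obtain ⟨φ, g, h1, h2, h3⟩ := S.exists_potential hη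
  exact ⟨⟨φ, g, hη, h1, h2, h3⟩⟩

namespace Potential

variable (F : S.Potential ε)

theorem continuous_halfEdge (F : S.Potential ε) (c : C) : Continuous (S.halfEdge ε c) :=
  (S.differentiable_halfEdge F.contDiff c).continuous

theorem continuous_curvature (F : S.Potential ε) (v : ℂ) : Continuous (S.curvature ε v) := by
  have := F.continuous_halfEdge
  unfold curvature
  fun_prop

theorem continuous_φ : Continuous F.φ :=
  continuous_iff_continuousAt.2 fun x => (F.hasFDerivAt_φ x).continuousAt

theorem φ_add_eq (x v : ℂ) : F.φ (x + v) = F.φ x + dot (F.g x) v +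
    ∫ t in (0 : ℝ)..1, (1 - t) * S.curvature ε v (x + t • v) := by
  have hl : ∀ t : ℝ, HasDerivAt (fun t : ℝ => x + t • v) v t := fun t => by
    simpa using ((hasDerivAt_id t).smul_const v).const_add x
  have h := taylor_one (f := fun t : ℝ => F.φ (x + t • v)) (f' := fun t => dotL (F.g (x + t • v)) v)
    (f'' := fun t => S.curvature ε v (x + t • v))
    (fun t => (F.hasFDerivAt_φ _).comp_hasDerivAt t (hl t)) (fun t => ?_)
    (by have := F.continuous_curvature v; fun_prop)
  · simpa [dotL_apply] using h
  · have h1 := (F.hasFDerivAt_g _).comp_hasDerivAt t (hl t)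
    have h2 := (dotL.flip v).hasFDerivAt.comp_hasDerivAt t h1
    refine h2.congr_deriv ?_
    rw [ContinuousLinearMap.flip_apply, dotL_apply, tensor_apply, curvature]
    simp only [dot, Complex.re_sum, Complex.im_sum, Finset.sum_mul, ← Finset.sum_add_distrib]
    refine Finset.sum_congr rfl fun c _ => ?_
    simp
    ring

theorem g_eq_zero {x : ℂ} (hx : ∀ y, F.φ y ≤ F.φ x) : F.g x = 0 := by
  have hl : IsLocalMax F.φ x := Filter.Eventually.of_forall hx
  have h := hl.hasFDerivAt_eq_zero (F.hasFDerivAt_φ x)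
  apply Complex.ext
  · simpa [dotL_apply, dot] using congrArg (fun l => l 1) h
  · simpa [dotL_apply, dot] using congrArg (fun l => l Complex.I) h

theorem exists_forall_le : ∃ x, ∀ y, F.φ y ≤ F.φ x := by
  have hK : IsCompact (Set.Icc 0 S.b₁ ×ℂ Set.Icc 0 S.b₂) := isCompact_Icc.reProdIm isCompact_Icc
  have hb₁ := S.b₁_pos
  have hb₂ := S.b₂_pos
  obtain ⟨x, -, hx⟩ := hK.exists_isMaxOn ⟨0, by simp [Complex.mem_reProdIm, hb₁.le, hb₂.le]⟩
    F.continuous_φ.continuousOn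
  refine ⟨x, fun y => ?_⟩
  rw [← F.φ_add y (-⌊y.re / S.b₁⌋, -⌊y.im / S.b₂⌋)]
  refine hx ?_
  have h1 := Int.sub_floor_div_mul_nonneg y.re hb₁
  have h2 := Int.sub_floor_div_mul_lt y.re hb₁
  have h3 := Int.sub_floor_div_mul_nonneg y.im hb₂
  have h4 := Int.sub_floor_div_mul_lt y.im hb₂
  simp only [Complex.mem_reProdIm, lam, rectVec, Complex.add_re, Complex.add_im, Int.cast_neg,
    neg_mul, ← sub_eq_add_neg]
  exact ⟨⟨h1, h2.le⟩, ⟨h3, h4.le⟩⟩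

/-- A maximum point propagates along vectors in whose direction there is no curvature. -/
theorem φ_add_eq_of_max {x : ℂ} (hx : ∀ y, F.φ y ≤ F.φ x) {v : ℂ}
    (hv : ∀ c, ∀ t ∈ Set.Icc (0 : ℝ) 1, S.W c ≠ 0 → S.halfEdge ε c (x + t • v) ≠ 0 →
      dot (S.nor c) v = 0) : F.φ (x + v) = F.φ x := by
  rw [F.φ_add_eq, F.g_eq_zero hx, intervalIntegral.integral_congr (g := fun _ => 0)]
  · simp [dot]
  · intro t ht
    rw [Set.uIcc_of_le zero_le_one] at ht
    beta_reduce
    rw [curvature, Finset.sum_eq_zero, mul_zero]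
    intro c _
    by_cases h1 : S.W c = 0
    · simp [h1]
    by_cases h2 : S.halfEdge ε c (x + t • v) = 0
    · rw [h2, mul_zero]
    · simp [hv c t ht h1 h2]

theorem exists_max_near_edge (hε : 0 < ε) {c₀ : C} (hc₀ : S.W c₀ ≠ 0) :
    ∃ x, (∀ y, F.φ y ≤ F.φ x) ∧ ∃ c z τ, S.W c ≠ 0 ∧ 0 ≤ τ ∧ τ ≤ S.r (S.s c) ∧
      ‖x - S.edgePoint c z τ‖ < 2 * ε := by
  obtain ⟨x₀, hx₀⟩ := F.exists_forall_le
  have hclosed : IsClosed {x | F.φ x = F.φ x₀} := isClosed_eq F.continuous_φ continuous_const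
  obtain ⟨x, hxE, hx⟩ := hclosed.exists_infDist_eq_dist ⟨x₀, rfl⟩ (S.P (S.s c₀))
  have hmax : ∀ y, F.φ y ≤ F.φ x := fun y => (hx₀ y).trans_eq hxE.symm
  refine ⟨x, hmax, ?_⟩
  by_contra! hfar
  have hne : 0 < ‖S.P (S.s c₀) - x‖ := by
    rw [norm_pos_iff, sub_ne_zero]
    intro h
    have := hfar c₀ 0 0 hc₀ le_rfl (S.r_pos _).le
    rw [edgePoint, lam_zero, zero_smul, h] at this
    simp at this
    linarith
  set d := ‖S.P (S.s c₀) - x‖ with hd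
  have hs : 0 < min 1 (ε / (2 * d)) := by positivity
  set s := min 1 (ε / (2 * d)) with hs_def
  have hs1 : s ≤ 1 := min_le_left _ _
  have hsd : s * d < ε := by
    have h1 : s * d ≤ ε / (2 * d) * d := by gcongr; exact min_le_right _ _
    have h2 : ε / (2 * d) * d = ε / 2 := by field_simp
    linarith
  have hstep : F.φ (x + s • (S.P (S.s c₀) - x)) = F.φ x := by
    refine F.φ_add_eq_of_max hmax fun c t ht hc hhe => ?_
    obtain ⟨z, τ, h0, h1, h2⟩ := exists_edgePoint_of_halfEdge_ne_zero hε hhe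
    have h3 := hfar c z τ hc h0 h1
    have h4 := norm_sub_le (x + t • s • (S.P (S.s c₀) - x) - S.edgePoint c z τ)
      (t • s • (S.P (S.s c₀) - x))
    rw [show x + t • s • (S.P (S.s c₀) - x) - S.edgePoint c z τ - t • s • (S.P (S.s c₀) - x) =
      x - S.edgePoint c z τ by abel, norm_smul, norm_smul, Real.norm_of_nonneg ht.1,
      Real.norm_of_nonneg hs.le, ← hd] at h4
    have h5 : t * (s * d) ≤ 1 * (s * d) := by gcongr; exact ht.2
    linarith
  have h1 : Metric.infDist (S.P (S.s c₀)) {x | F.φ x = F.φ x₀} ≤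
      dist (S.P (S.s c₀)) (x + s • (S.P (S.s c₀) - x)) :=
    Metric.infDist_le_dist_of_mem (hstep.trans hxE)
  rw [hx, dist_eq_norm, dist_eq_norm, ← hd,
    show S.P (S.s c₀) - (x + s • (S.P (S.s c₀) - x)) = (1 - s) • (S.P (S.s c₀) - x) by
      rw [sub_smul, one_smul]; abel, norm_smul, ← hd, Real.norm_of_nonneg (by linarith)] at h1
  nlinarith

theorem exists_max_near_center (h : S.Scale κ ρ ε) {c₀ : C} (hc₀ : S.W c₀ ≠ 0) :
    ∃ x, (∀ y, F.φ y ≤ F.φ x) ∧ ∃ c, S.W c ≠ 0 ∧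
      ‖x - S.P (S.s c)‖ < (2 + 8 / κ) * ε := by
  have hε := h.ε_pos
  suffices hs : ∃ x, (∀ y, F.φ y ≤ F.φ x) ∧ ∃ c z, S.W c ≠ 0 ∧
      ‖x - (S.P (S.s c) + S.lam z)‖ < (2 + 8 / κ) * ε by
    obtain ⟨x, hx, c, z, hc, hxc⟩ := hs
    refine ⟨x - S.lam z, fun y => ?_, c, hc, ?_⟩
    · rw [← F.φ_add (x - S.lam z) z, sub_add_cancel]
      exact hx y
    · rwa [sub_sub, add_comm (S.lam z)]
  by_contra! hfar
  obtain ⟨x, hx, c, z, τ, hc, h0, h1, hxc⟩ := F.exists_max_near_edge hε hc₀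
  have key : ∀ n : ℕ, n * ε ≤ τ → ∀ y, F.φ y ≤ F.φ (x - (n * ε) • S.u c) := by
    intro n
    induction n with
    | zero => simpa using fun _ => hx
    | succ n ih =>
      intro hn
      push_cast at hn
      have hmax := ih (by linarith)
      set y := x - (n * ε) • S.u c with hy
      have hyc : ‖y - S.edgePoint c z (τ - n * ε)‖ < 2 * ε := by
        rwa [hy, edgePoint, show x - (n * ε) • S.u c - (S.P (S.s c) + S.lam z +
          (τ - n * ε) • S.u c) = x - S.edgePoint c z τ by rw [edgePoint, sub_smul]; abel]
      have hstep : F.φ (y + (-ε) • S.u c) = F.φ y := by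
        refine F.φ_add_eq_of_max hmax fun c' t ht hc' hhe => ?_
        obtain ⟨z', τ', h0', h1', h2'⟩ := exists_edgePoint_of_halfEdge_ne_zero hε hhe
        have h3 : ‖y - S.edgePoint c' z' τ'‖ < 2 * ε := by
          have h4 := norm_sub_le (y + t • (-ε) • S.u c - S.edgePoint c' z' τ')
            (t • (-ε) • S.u c)
          rw [show y + t • (-ε) • S.u c - S.edgePoint c' z' τ' - t • (-ε) • S.u c =
            y - S.edgePoint c' z' τ' by abel, norm_smul, norm_smul, Real.norm_of_nonneg ht.1,
            norm_u, norm_neg, Real.norm_of_nonneg hε.le] at h4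
          nlinarith [ht.2]
        have hn0 : 0 ≤ n * ε := by positivity
        rcases h.parallel_or_near (by linarith) (by linarith) hyc h0' h1' h3 with h5 | h5 | h5
        · simp [nor, h5, dot]
          ring
        · simp [nor, h5, dot]
          ring
        · exact absurd (hfar y hmax c z hc) h5.not_ge
      have e : x - (((n + 1 : ℕ) : ℝ) * ε) • S.u c = y + (-ε) • S.u c := by
        rw [hy, Nat.cast_succ, add_mul, add_smul, one_mul, neg_smul]
        abel
      rw [e, hstep]
      exact hmax
  have hfl := Nat.floor_le (div_nonneg h0 hε.le)
  have hfl' := Nat.lt_floor_add_one (τ / ε)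
  rw [le_div_iff₀ hε] at hfl
  rw [div_lt_iff₀ hε] at hfl'
  have h2 := hfar _ (key _ hfl) c z hc
  have h3 : ‖x - ((⌊τ / ε⌋₊ : ℝ) * ε) • S.u c - (S.P (S.s c) + S.lam z)‖ ≤
      ‖x - S.edgePoint c z τ‖ + ‖(τ - ⌊τ / ε⌋₊ * ε) • S.u c‖ := by
    refine le_of_eq_of_le ?_ (norm_add_le _ _)
    congr 1
    rw [edgePoint, sub_smul]
    abel
  rw [norm_smul, norm_u, mul_one, Real.norm_of_nonneg (by linarith)] at h3
  have h4 : 8 ≤ 8 / κ := by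
    rw [le_div_iff₀ h.κ_pos]
    linarith [h.κ_le_one]
  nlinarith

end Potential

end StressedPacking

theorem dot_sq_le (a b : ℂ) : dot a b ^ 2 ≤ ‖a‖ ^ 2 * ‖b‖ ^ 2 := by
  rw [Complex.sq_norm, Complex.sq_norm, Complex.normSq_apply, Complex.normSq_apply, dot]
  nlinarith [sq_nonneg (a.re * b.im - a.im * b.re)]

namespace StressedPacking

variable {ι C : Type} [Fintype C] {S : StressedPacking ι C} {κ ρ ε : ℝ}

theorem norm_nor (c : C) : ‖S.nor c‖ = 1 := by
  rw [nor, norm_mul, Complex.norm_I, one_mul, norm_u]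

theorem halfEdge_nonneg (c : C) (x : ℂ) : 0 ≤ S.halfEdge ε c x :=
  intervalIntegral.integral_nonneg (S.r_pos _).le fun _ _ => mollifier_nonneg _

theorem Scale.exists_of_halfEdge_ne_zero (h : S.Scale κ ρ ε) {c c' : C} {y : ℂ}
    (hy : ‖y - S.P (S.s c)‖ ≤ ρ / 2) (hhe : S.halfEdge ε c' y ≠ 0) :
    S.s c' = S.s c ∧ ∃ τ : ℝ, 0 ≤ τ ∧ ‖y - S.P (S.s c) - τ • S.u c'‖ < ε := by
  obtain ⟨z, τ, h0, h1, h2⟩ := exists_edgePoint_of_halfEdge_ne_zero h.ε_pos hhe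
  by_cases hs : S.s c' = S.s c ∧ z = 0
  · refine ⟨hs.1, τ, h0, ?_⟩
    rwa [edgePoint, hs.1, hs.2, lam_zero, add_zero, ← sub_sub] at h2
  · exfalso
    have h3 := S.le_norm_sub (S.s c) (S.s c') 0 z hs
    rw [lam_zero, add_zero] at h3
    have h4 := norm_sub_le_norm_sub_add_norm_sub (S.P (S.s c)) y (S.P (S.s c') + S.lam z)
    have h5 := norm_sub_le_norm_sub_add_norm_sub y (S.edgePoint c' z τ)
      (S.P (S.s c') + S.lam z)
    rw [norm_edgePoint_sub _ _ h0] at h5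
    rw [norm_sub_rev _ y] at h4
    linarith [h.ρ_le c, h.ε_le, h.ρ_pos]

theorem Scale.halfEdge_eq (h : S.Scale κ ρ ε) {c : C} {y : ℂ}
    (hy : ‖y - S.P (S.s c)‖ ≤ ρ / 2) : S.halfEdge ε c y =
      ∫ τ in 0..S.r (S.s c), cutoff ε ‖y - S.P (S.s c) - (τ : ℝ) • S.u c‖ := by
  refine intervalIntegral.integral_congr fun τ hτ => ?_
  rw [Set.uIcc_of_le (S.r_pos _).le] at hτ
  refine mollifier_eq h.ε_pos fun z hz => ?_
  have h1 := S.two_mul_r_le (S.s c) z hz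
  have h2 := norm_sub_le (y - S.P (S.s c)) (τ • S.u c)
  rw [norm_smul, norm_u, mul_one, Real.norm_of_nonneg hτ.1] at h2
  rw [lam] at h1
  linarith [h.ρ_le c, h.ε_le, h.ρ_pos, hτ.2]

theorem Scale.halfEdge_le (h : S.Scale κ ρ ε) {c : C} {y : ℂ} {a : ℝ} (ha : a ≤ ρ / 2)
    (hy : ‖y - S.P (S.s c)‖ ≤ a) : S.halfEdge ε c y ≤ a + ε := by
  have hc : Continuous fun τ : ℝ => cutoff ε ‖y - S.P (S.s c) - τ • S.u c‖ :=
    (continuous_cutoff ε).comp (by fun_prop)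
  have ha0 : 0 ≤ a := (norm_nonneg _).trans hy
  have hε := h.ε_pos
  rw [h.halfEdge_eq (hy.trans ha), ← intervalIntegral.integral_add_adjacent_intervals
    (b := a + ε) (hc.intervalIntegrable _ _) (hc.intervalIntegrable _ _)]
  have h1 : (∫ τ in 0..(a + ε), cutoff ε ‖y - S.P (S.s c) - (τ : ℝ) • S.u c‖) ≤
      ∫ _ in 0..(a + ε), (1 : ℝ) :=
    intervalIntegral.integral_mono_on (by linarith) (hc.intervalIntegrable _ _)
      intervalIntegrable_const fun τ _ => cutoff_le_one _ _
  have h2 : (∫ τ in (a + ε)..S.r (S.s c), cutoff ε ‖y - S.P (S.s c) - (τ : ℝ) • S.u c‖) =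
      ∫ _ in (a + ε)..S.r (S.s c), (0 : ℝ) := by
    refine intervalIntegral.integral_congr fun τ hτ => ?_
    rw [Set.uIcc_of_le (by linarith [h.ρ_le c, h.ε_le, h.ρ_pos])] at hτ
    refine cutoff_eq_zero hε ?_
    have h2 := norm_sub_norm_le (τ • S.u c) (y - S.P (S.s c))
    rw [norm_smul, norm_u, mul_one, Real.norm_of_nonneg (by linarith [hτ.1]),
      norm_sub_rev (τ • S.u c)] at h2
    linarith [hτ.1]
  rw [h2]
  simpa using h1

theorem Scale.abs_curvature_le (h : S.Scale κ ρ ε) {c : C} {v y : ℂ} {a : ℝ} (ha : a ≤ ρ / 2)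
    (hy : ‖y - S.P (S.s c)‖ ≤ a) :
    |S.curvature ε v y| ≤ (∑ c, |S.W c|) * (‖v‖ ^ 2 * (a + ε)) := by
  have ha0 : 0 ≤ a := (norm_nonneg _).trans hy
  have hε := h.ε_pos
  rw [curvature, Finset.sum_mul]
  refine (Finset.abs_sum_le_sum_abs _ _).trans (Finset.sum_le_sum fun c' _ => ?_)
  rw [abs_mul, abs_mul, mul_assoc, abs_of_nonneg (halfEdge_nonneg c' y),
    abs_of_nonneg (sq_nonneg (dot _ _))]
  have h1 := dot_sq_le (S.nor c') v
  rw [norm_nor, one_pow, one_mul] at h1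
  have h2 : S.halfEdge ε c' y ≤ a + ε := by
    by_cases h0 : S.halfEdge ε c' y = 0
    · rw [h0]
      linarith
    · have h3 := (h.exists_of_halfEdge_ne_zero (hy.trans ha) h0).1
      exact h.halfEdge_le ha (by rwa [h3])
  have h0 := halfEdge_nonneg (S := S) (ε := ε) c' y
  gcongr

theorem Potential.max_sub_le (F : S.Potential ε) (h : S.Scale κ ρ ε) {c : C} {x : ℂ} {a : ℝ}
    (ha : a ≤ ρ / 2) (hx : ∀ y, F.φ y ≤ F.φ x) (hxc : ‖x - S.P (S.s c)‖ ≤ a) :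
    F.φ x - F.φ (S.P (S.s c)) ≤ (∑ c, |S.W c|) * (a ^ 2 * (a + ε)) := by
  have hε := h.ε_pos
  have ha0 : 0 ≤ a := (norm_nonneg _).trans hxc
  have h1 := F.φ_add_eq x (S.P (S.s c) - x)
  rw [F.g_eq_zero hx, add_sub_cancel] at h1
  simp only [dot, Complex.zero_re, Complex.zero_im, zero_mul, add_zero] at h1
  have h2 := intervalIntegral.norm_integral_le_of_norm_le_const (a := 0) (b := 1)
    (f := fun t => (1 - t) * S.curvature ε (S.P (S.s c) - x) (x + t • (S.P (S.s c) - x)))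
    (C := (∑ c, |S.W c|) * (a ^ 2 * (a + ε))) fun t ht => ?_
  · rw [Real.norm_eq_abs, sub_zero, abs_one, mul_one] at h2
    linarith [neg_abs_le (∫ t in (0 : ℝ)..1,
      (1 - t) * S.curvature ε (S.P (S.s c) - x) (x + t • (S.P (S.s c) - x)))]
  · rw [Set.uIoc_of_le zero_le_one] at ht
    have h3 : ‖x + t • (S.P (S.s c) - x) - S.P (S.s c)‖ ≤ a := by
      have e : x + t • (S.P (S.s c) - x) - S.P (S.s c) = (1 - t) • (x - S.P (S.s c)) := by
        rw [sub_smul, one_smul, smul_sub, smul_sub]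
        abel
      rw [e, norm_smul, Real.norm_of_nonneg (by linarith [ht.2])]
      nlinarith [ht.1, norm_nonneg (x - S.P (S.s c))]
    have h4 := h.abs_curvature_le (v := S.P (S.s c) - x) ha h3
    rw [norm_sub_rev] at h4
    rw [norm_mul, Real.norm_of_nonneg (by linarith [ht.2]), Real.norm_eq_abs]
    have h5 : (∑ c, |S.W c|) * (‖x - S.P (S.s c)‖ ^ 2 * (a + ε)) ≤
        (∑ c, |S.W c|) * (a ^ 2 * (a + ε)) := by gcongr
    nlinarith [ht.1, abs_nonneg (S.curvature ε (S.P (S.s c) - x) (x + t • (S.P (S.s c) - x)))]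

end StressedPacking

theorem integral_rotate {f : ℂ → ℝ} {a : ℂ} (ha : ‖a‖ = 1) (R : ℝ) :
    (∫ θ in -Real.pi..Real.pi, f (a * (R * Complex.exp (θ * Complex.I)))) =
      ∫ θ in -Real.pi..Real.pi, f (R * Complex.exp (θ * Complex.I)) := by
  have hp : Function.Periodic (fun θ : ℝ => f (R * Complex.exp (θ * Complex.I)))
      (2 * Real.pi) := fun θ => by
    have := Complex.exp_periodic (θ * Complex.I)
    beta_reduce
    rw [← this]
    push_cast
    ring_nf
  have h := intervalIntegral.integral_comp_add_right (a := -Real.pi) (b := Real.pi)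
    (fun θ : ℝ => f (R * Complex.exp (θ * Complex.I))) a.arg
  have h2 := hp.intervalIntegral_add_eq (-Real.pi + a.arg) (-Real.pi)
  rw [show -Real.pi + a.arg + 2 * Real.pi = Real.pi + a.arg by ring,
    show -Real.pi + 2 * Real.pi = Real.pi by ring] at h2
  rw [← h2, ← h]
  refine intervalIntegral.integral_congr fun θ _ => ?_
  have h3 := Complex.norm_mul_exp_arg_mul_I a
  rw [ha, Complex.ofReal_one, one_mul] at h3
  congr 1
  nth_rw 1 [← h3]
  push_cast
  rw [add_mul, Complex.exp_add]
  ring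

/-- The contribution of a half-edge of length `r` in the direction of the real axis to the
second order variation of a potential in the direction `w`. -/
def angular (ε r : ℝ) (w : ℂ) : ℝ :=
  ∫ t in (0 : ℝ)..1, (1 - t) * (w.im ^ 2 * ∫ τ in 0..r, cutoff ε ‖t • w - (τ : ℂ)‖)

theorem continuous_angular (ε r : ℝ) : Continuous (angular ε r) := by
  have h1 : Continuous fun p : (ℂ × ℝ) × ℝ => cutoff ε ‖p.1.2 • p.1.1 - (p.2 : ℂ)‖ :=
    (continuous_cutoff ε).comp (by fun_prop)
  have h2 : Continuous fun p : ℂ × ℝ => ∫ τ in 0..r, cutoff ε ‖p.2 • p.1 - (τ : ℂ)‖ :=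
    intervalIntegral.continuous_parametric_intervalIntegral_of_continuous' h1 _ _
  refine intervalIntegral.continuous_parametric_intervalIntegral_of_continuous' ?_ _ _
  change Continuous fun p : ℂ × ℝ =>
    (1 - p.2) * (p.1.im ^ 2 * ∫ τ in 0..r, cutoff ε ‖p.2 • p.1 - (τ : ℂ)‖)
  fun_prop

theorem integral_dot_exp (a b : ℂ) :
    (∫ θ in -Real.pi..Real.pi, dot a (b * Complex.exp (θ * Complex.I))) = 0 := by
  have h : ∀ θ : ℝ, dot a (b * Complex.exp (θ * Complex.I)) =
      dot a b * Real.cos θ + dot a (Complex.I * b) * Real.sin θ := fun θ => by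
    rw [Complex.exp_mul_I]
    simp [dot, Complex.cos_ofReal_re, Complex.sin_ofReal_re]
    ring
  simp only [h]
  rw [intervalIntegral.integral_add (Continuous.intervalIntegrable (by fun_prop) _ _)
    (Continuous.intervalIntegrable (by fun_prop) _ _)]
  simp

namespace StressedPacking

variable {ι C : Type} [Fintype C] {S : StressedPacking ι C} {κ ρ ε : ℝ}

open ComplexConjugate

theorem dot_nor (c : C) (v : ℂ) : dot (S.nor c) v = (conj (S.u c) * v).im := by
  simp [dot, nor]
  ring

theorem conj_u_mul_u (c : C) : conj (S.u c) * S.u c = 1 := by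
  rw [mul_comm, Complex.mul_conj, Complex.normSq_eq_norm_sq, norm_u]
  simp

theorem norm_conj_u_mul (c : C) (x : ℂ) : ‖conj (S.u c) * x‖ = ‖x‖ := by
  rw [norm_mul, RCLike.norm_conj, norm_u, one_mul]

open Classical in
theorem Scale.integral_halfEdge (h : S.Scale κ ρ ε) (c c' : C) {v : ℂ} (hv : ‖v‖ ≤ ρ / 2) :
    (∫ t in (0 : ℝ)..1, (1 - t) * (dot (S.nor c') v ^ 2 *
      S.halfEdge ε c' (S.P (S.s c) + t • v))) =
      (if S.s c' = S.s c then 1 else 0) * angular ε (S.r (S.s c)) (conj (S.u c') * v) := by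
  have hn : ∀ t ∈ Set.Icc (0 : ℝ) 1, ‖S.P (S.s c) + t • v - S.P (S.s c)‖ ≤ ρ / 2 := fun t ht => by
    rw [add_sub_cancel_left, norm_smul, Real.norm_of_nonneg ht.1]
    nlinarith [ht.2, norm_nonneg v]
  split_ifs with hs
  · rw [one_mul, angular]
    refine intervalIntegral.integral_congr fun t ht => ?_
    rw [Set.uIcc_of_le zero_le_one] at ht
    have h1 := hn t ht
    rw [← hs] at h1 ⊢
    rw [h.halfEdge_eq h1, dot_nor]
    congr 2
    refine intervalIntegral.integral_congr fun τ _ => ?_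
    rw [← norm_conj_u_mul c', add_sub_cancel_left, mul_sub, mul_smul_comm, mul_smul_comm,
      conj_u_mul_u, Complex.real_smul (x := τ), mul_one]
  · rw [zero_mul, intervalIntegral.integral_congr (g := fun _ => 0)]
    · simp
    · intro t ht
      rw [Set.uIcc_of_le zero_le_one] at ht
      have h2 : S.halfEdge ε c' (S.P (S.s c) + t • v) = 0 := by
        by_contra h0
        exact hs (h.exists_of_halfEdge_ne_zero (hn t ht) h0).1
      beta_reduce
      rw [h2, mul_zero, mul_zero]

open Classical in
theorem Potential.φ_center_add (F : S.Potential ε) (h : S.Scale κ ρ ε) (c : C) {v : ℂ}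
    (hv : ‖v‖ ≤ ρ / 2) : F.φ (S.P (S.s c) + v) = F.φ (S.P (S.s c)) + dot (F.g (S.P (S.s c))) v +
      ∑ c', (S.W c' * if S.s c' = S.s c then 1 else 0) *
        angular ε (S.r (S.s c)) (conj (S.u c') * v) := by
  rw [F.φ_add_eq]
  congr 1
  have h1 : ∀ t : ℝ, (1 - t) * S.curvature ε v (S.P (S.s c) + t • v) =
      ∑ c', S.W c' * ((1 - t) * (dot (S.nor c') v ^ 2 *
        S.halfEdge ε c' (S.P (S.s c) + t • v))) := fun t => by
    rw [curvature, Finset.mul_sum]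
    refine Finset.sum_congr rfl fun c' _ => ?_
    ring
  simp only [h1]
  rw [intervalIntegral.integral_finsetSum fun c' _ => ?_]
  · refine Finset.sum_congr rfl fun c' _ => ?_
    rw [intervalIntegral.integral_const_mul, h.integral_halfEdge c c' hv, mul_assoc]
  · refine Continuous.intervalIntegrable ?_ _ _
    have := F.continuous_halfEdge c'
    fun_prop

theorem Potential.circle_mean (F : S.Potential ε) (h : S.Scale κ ρ ε) (c : C) {a : ℂ}
    (ha : ‖a‖ = 1) :
    (∫ θ in -Real.pi..Real.pi,
      F.φ (S.P (S.s c) + a * ((ρ / 2 : ℝ) * Complex.exp (θ * Complex.I)))) =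
      2 * Real.pi * F.φ (S.P (S.s c)) := by
  classical
  have hv : ∀ θ : ℝ, ‖a * ((ρ / 2 : ℝ) * Complex.exp (θ * Complex.I))‖ ≤ ρ / 2 := fun θ => by
    rw [norm_mul, norm_mul, ha, Complex.norm_exp_ofReal_mul_I, one_mul, mul_one, Complex.norm_real,
      Real.norm_of_nonneg (by linarith [h.ρ_pos])]
  simp only [fun θ => F.φ_center_add h c (hv θ)]
  have hcont := continuous_angular ε (S.r (S.s c))
  have hdot : Continuous fun θ : ℝ =>
      dot (F.g (S.P (S.s c))) (a * ((ρ / 2 : ℝ) * Complex.exp (θ * Complex.I))) := by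
    simp only [← dotL_apply]
    fun_prop
  rw [intervalIntegral.integral_add, intervalIntegral.integral_add,
    intervalIntegral.integral_finsetSum]
  · have h1 : ∀ c', (∫ θ in -Real.pi..Real.pi, (S.W c' * if S.s c' = S.s c then 1 else 0) *
        angular ε (S.r (S.s c)) (conj (S.u c') * (a * ((ρ / 2 : ℝ) *
          Complex.exp (θ * Complex.I))))) =
        (S.W c' * if S.s c' = S.s c then 1 else 0) * ∫ θ in -Real.pi..Real.pi,
          angular ε (S.r (S.s c)) ((ρ / 2 : ℝ) * Complex.exp (θ * Complex.I)) := fun c' => by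
      rw [intervalIntegral.integral_const_mul]
      simp only [← mul_assoc (conj (S.u c'))]
      rw [integral_rotate (by rw [norm_conj_u_mul, ha])]
    simp only [h1]
    rw [← Finset.sum_mul, S.sum_W fun i => if i = S.s c then 1 else 0, zero_mul, add_zero]
    simp only [← mul_assoc a]
    rw [integral_dot_exp, intervalIntegral.integral_const, smul_eq_mul, add_zero]
    ring
  · exact fun c' _ => Continuous.intervalIntegrable (by fun_prop) _ _
  · exact intervalIntegrable_const
  · exact hdot.intervalIntegrable _ _
  · exact Continuous.intervalIntegrable (by fun_prop) _ _
  · exact Continuous.intervalIntegrable (by fun_prop) _ _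

theorem Scale.halfEdge_ge (h : S.Scale κ ρ ε) {c : C} {y : ℂ} {a : ℝ}
    (hy : ‖y - S.P (S.s c)‖ ≤ ρ / 2) (hε : ε ≤ a) (ha : a ≤ ρ / 2)
    (hya : ‖y - S.P (S.s c) - a • S.u c‖ ≤ ε / 4) : ε / 2 ≤ S.halfEdge ε c y := by
  have hc : Continuous fun τ : ℝ => cutoff ε ‖y - S.P (S.s c) - τ • S.u c‖ :=
    (continuous_cutoff ε).comp (by fun_prop)
  have hε0 := h.ε_pos
  rw [h.halfEdge_eq hy]
  have h1 : (∫ _ in (a - ε / 4)..(a + ε / 4), (1 : ℝ)) ≤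
      ∫ τ in (a - ε / 4)..(a + ε / 4), cutoff ε ‖y - S.P (S.s c) - (τ : ℝ) • S.u c‖ := by
    refine intervalIntegral.integral_mono_on (by linarith) intervalIntegrable_const
      (hc.intervalIntegrable _ _) fun τ hτ => (cutoff_eq_one hε0 (norm_nonneg _) ?_).ge
    have h2 := norm_add_le (y - S.P (S.s c) - a • S.u c) ((a - τ) • S.u c)
    rw [sub_smul, sub_add_sub_cancel, ← sub_smul, norm_smul, norm_u, mul_one,
      Real.norm_eq_abs] at h2
    have h3 : |a - τ| ≤ ε / 4 := abs_le.2 ⟨by linarith [hτ.2], by linarith [hτ.1]⟩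
    linarith
  have h2 := intervalIntegral.integral_mono_interval (μ := MeasureTheory.volume) (c := 0)
    (a := a - ε / 4) (b := a + ε / 4) (d := S.r (S.s c))
    (f := fun τ => cutoff ε ‖y - S.P (S.s c) - (τ : ℝ) • S.u c‖) (by linarith) (by linarith)
    (by linarith [h.ρ_le c, h.ε_le, h.ρ_pos])
    (Filter.Eventually.of_forall fun _ => cutoff_nonneg _ _) (hc.intervalIntegrable _ _)
  rw [intervalIntegral.integral_const, smul_eq_mul] at h1
  linarith

theorem Scale.curvature_eq (h : S.Scale κ ρ ε) {c : C} {y : ℂ} {a b : ℝ}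
    (hy : ‖y - S.P (S.s c)‖ ≤ ρ / 2) (ha : 0 ≤ a) (hab : 2 * (b + ε) < a * κ)
    (hya : ‖y - S.P (S.s c) - a • S.u c‖ ≤ b) (v : ℂ) :
    S.curvature ε v y = S.W c * dot (S.nor c) v ^ 2 * S.halfEdge ε c y := by
  refine Finset.sum_eq_single_of_mem c (Finset.mem_univ c) fun c' _ hc' => ?_
  suffices hhe : S.halfEdge ε c' y = 0 by rw [hhe, mul_zero]
  by_contra hhe
  obtain ⟨hs, τ, h0, h1⟩ := h.exists_of_halfEdge_ne_zero hy hhe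
  have h2 := h.κ_le c c' fun hu => hc' (S.eq_of_u_eq hs hu.symm)
  have h3 := smul_norm_sub_le (S.norm_u c') (S.norm_u c) ha h0
  have h4 := norm_sub_le_norm_sub_add_norm_sub (a • S.u c) (y - S.P (S.s c)) (τ • S.u c')
  rw [norm_sub_rev (a • S.u c) (y - _)] at h4
  have h5 := mul_le_mul_of_nonneg_left h2 ha
  linarith

/-- A compressed edge bends a potential downwards in the direction transversal to it. -/
theorem Potential.φ_add_le (F : S.Potential ε) (h : S.Scale κ ρ ε) {c : C} (hW : S.W c ≤ 0)
    {a d : ℝ} {v : ℂ} (hv : ‖v‖ = d) (hnv : dot (S.nor c) v ^ 2 = d ^ 2)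
    (hεa : ε ≤ a) (ha : a ≤ ρ / 2) (hεd : ε ≤ 2 * d) (hda : 2 * (d + ε) < a * κ)
    (hav : ‖a • S.u c + v‖ ≤ ρ / 2) :
    F.φ (S.P (S.s c) + a • S.u c + v) ≤ F.φ (S.P (S.s c) + a • S.u c) +
      dot (F.g (S.P (S.s c) + a • S.u c)) v + S.W c * (d * ε ^ 2 / 16) := by
  have hε := h.ε_pos
  have hd : 0 < d := by linarith
  have ha0 : 0 ≤ a := by linarith
  rw [F.φ_add_eq]
  gcongr
  set m := S.P (S.s c) + a • S.u c with hm
  have hsub : ∀ t : ℝ, m + t • v - S.P (S.s c) = a • S.u c + t • v := fun t => by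
    rw [hm]
    abel
  have hn : ∀ t ∈ Set.Icc (0 : ℝ) 1, ‖m + t • v - S.P (S.s c)‖ ≤ ρ / 2 := fun t ht => by
    have e : a • S.u c + t • v = (1 - t) • (a • S.u c) + t • (a • S.u c + v) := by
      rw [sub_smul, smul_add, one_smul]
      abel
    have h1 := norm_add_le ((1 - t) • (a • S.u c)) (t • (a • S.u c + v))
    rw [norm_smul, norm_smul, norm_smul, norm_u, Real.norm_of_nonneg ht.1, Real.norm_of_nonneg ha0,
      Real.norm_of_nonneg (by linarith [ht.2]), mul_one] at h1
    rw [hsub, e]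
    nlinarith [ht.1, ht.2]
  have hna : ∀ t ∈ Set.Icc (0 : ℝ) 1,
      ‖m + t • v - S.P (S.s c) - a • S.u c‖ = t * d := fun t ht => by
    rw [hsub, add_sub_cancel_left, norm_smul, hv, Real.norm_of_nonneg ht.1]
  have h1 : ∀ t ∈ Set.Icc (0 : ℝ) 1, S.curvature ε v (m + t • v) =
      S.W c * d ^ 2 * S.halfEdge ε c (m + t • v) := fun t ht => by
    rw [h.curvature_eq (hn t ht) ha0 hda ((hna t ht).trans_le _), hnv]
    nlinarith [ht.2]
  have hcont := F.continuous_halfEdge c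
  have hi : ∀ b₁ b₂, IntervalIntegrable (fun t : ℝ => (1 - t) * S.halfEdge ε c (m + t • v))
      MeasureTheory.volume b₁ b₂ := fun b₁ b₂ =>
    (by fun_prop : Continuous fun t : ℝ =>
      (1 - t) * S.halfEdge ε c (m + t • v)).intervalIntegrable _ _
  have h2 : (∫ t in (0 : ℝ)..1, (1 - t) * S.curvature ε v (m + t • v)) =
      S.W c * d ^ 2 * ∫ t in (0 : ℝ)..1, (1 - t) * S.halfEdge ε c (m + t • v) := by
    rw [← intervalIntegral.integral_const_mul]
    refine intervalIntegral.integral_congr fun t ht => ?_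
    rw [Set.uIcc_of_le zero_le_one] at ht
    rw [h1 t ht]
    ring
  have ht0 : ε / (4 * d) ≤ 1 / 2 := by
    rw [div_le_div_iff₀ (by positivity) two_pos]
    linarith
  have ht0' : 0 ≤ ε / (4 * d) := by positivity
  have h3 : (∫ _ in (0 : ℝ)..(ε / (4 * d)), ε / 4) ≤
      ∫ t in (0 : ℝ)..(ε / (4 * d)), (1 - t) * S.halfEdge ε c (m + t • v) := by
    refine intervalIntegral.integral_mono_on ht0' intervalIntegrable_const (hi _ _) fun t ht => ?_
    have ht' : t ∈ Set.Icc (0 : ℝ) 1 := ⟨ht.1, by linarith [ht.2]⟩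
    have h4 : t * d ≤ ε / 4 := by
      have := mul_le_mul_of_nonneg_right ht.2 hd.le
      rwa [show ε / (4 * d) * d = ε / 4 by field_simp] at this
    have h5 := h.halfEdge_ge (hn t ht') hεa ha ((hna t ht').trans_le h4)
    nlinarith [ht.2]
  have h4 := intervalIntegral.integral_mono_interval (μ := MeasureTheory.volume) (c := 0)
    (a := 0) (b := ε / (4 * d)) (d := 1)
    (f := fun t : ℝ => (1 - t) * S.halfEdge ε c (m + t • v)) le_rfl ht0' (by linarith)
    ((MeasureTheory.ae_restrict_iff' measurableSet_Ioc).2 <| Filter.Eventually.of_forall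
      fun t ht => mul_nonneg (sub_nonneg.2 ht.2) (halfEdge_nonneg c _)) (hi _ _)
  rw [intervalIntegral.integral_const, smul_eq_mul, sub_zero] at h3
  have h5 : d * ε ^ 2 / 16 = d ^ 2 * (ε / (4 * d) * (ε / 4)) := by
    field_simp
    norm_num
  rw [h2, h5, mul_assoc]
  refine mul_le_mul_of_nonpos_left ?_ hW
  gcongr
  exact h3.trans h4

theorem integral_symm_ge {f : ℝ → ℝ} (hf : Continuous f) (h0 : ∀ θ, 0 ≤ f θ) {a b B c : ℝ}
    (ha : -B ≤ a) (hab : a ≤ b) (hb : b ≤ B) (hc : ∀ θ ∈ Set.Icc a b, c ≤ f θ + f (-θ)) :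
    (b - a) * c ≤ 2 * ∫ θ in -B..B, f θ := by
  have h1 := intervalIntegral.integral_comp_neg (a := -B) (b := B) f
  rw [neg_neg] at h1
  have hi : ∀ b₁ b₂, IntervalIntegrable (fun θ => f θ + f (-θ)) MeasureTheory.volume b₁ b₂ :=
    fun b₁ b₂ => (by fun_prop : Continuous fun θ => f θ + f (-θ)).intervalIntegrable _ _
  have h2 : (∫ θ in -B..B, (f θ + f (-θ))) = 2 * ∫ θ in -B..B, f θ := by
    rw [intervalIntegral.integral_add (hf.intervalIntegrable _ _)
      ((by fun_prop : Continuous fun θ => f (-θ)).intervalIntegrable _ _), h1, two_mul]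
  have h3 := intervalIntegral.integral_mono_interval (μ := MeasureTheory.volume) (c := -B)
    (a := a) (b := b) (d := B) ha hab hb
    (Filter.Eventually.of_forall fun θ => add_nonneg (h0 θ) (h0 (-θ))) (hi _ _)
  have h4 : (∫ _ in a..b, c) ≤ ∫ θ in a..b, (f θ + f (-θ)) :=
    intervalIntegral.integral_mono_on hab intervalIntegrable_const (hi _ _) hc
  rw [intervalIntegral.integral_const, smul_eq_mul] at h4
  linarith

theorem exists_W_neg {c₀ : C} (h : S.W c₀ ≠ 0) : ∃ c, S.s c = S.s c₀ ∧ S.W c < 0 := by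
  classical
  by_contra! hc
  have h1 := S.sum_W fun i => if i = S.s c₀ then 1 else 0
  rw [Finset.sum_eq_zero_iff_of_nonneg fun c _ => ?_] at h1
  · simpa [h] using h1 c₀ (Finset.mem_univ _)
  · split_ifs with hs
    · simpa using hc c hs
    · simp

theorem Potential.two_point_le (F : S.Potential ε) (h : S.Scale κ ρ ε) {c : C} (hW : S.W c ≤ 0)
    {α : ℝ} (hα : κ / 16 ≤ α) (hα' : α ≤ κ / 8) {M : ℝ} (hM : ∀ y, F.φ y ≤ M) :
    F.φ (S.P (S.s c) + S.u c * ((ρ / 2 : ℝ) * Complex.exp (α * Complex.I))) +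
      F.φ (S.P (S.s c) + S.u c * ((ρ / 2 : ℝ) * Complex.exp ((-α : ℝ) * Complex.I))) ≤
      2 * M + S.W c * (ρ * κ * ε ^ 2 / 512) := by
  have hκ := h.κ_pos
  have hκ1 := h.κ_le_one
  have hρ := h.ρ_pos
  have hε := h.ε_pos
  have hεκ : 32 * ε < ρ * κ := by
    have : ρ * κ ^ 2 ≤ ρ * κ := by gcongr; nlinarith
    linarith [h.ε_lt]
  have hα0 : 0 < α := by linarith
  have hsin_le := Real.sin_le hα0.le
  have hsin : κ / 32 ≤ Real.sin α := by
    have h1 := Real.mul_le_sin hα0.le (by linarith [Real.pi_gt_three])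
    have h2 : 1 / 2 ≤ 2 / Real.pi := by
      rw [div_le_div_iff₀ two_pos Real.pi_pos]
      linarith [Real.pi_le_four]
    nlinarith
  have hcos : 3 / 4 ≤ Real.cos α := by
    have := Real.one_sub_sq_div_two_le_cos (x := α)
    nlinarith
  have hcos_le := Real.cos_le_one α
  set a := ρ / 2 * Real.cos α with ha
  set d := ρ / 2 * Real.sin α with hd
  have ha_ge : 3 / 8 * ρ ≤ a := by nlinarith
  have ha_le : a ≤ ρ / 2 := by nlinarith
  have hd_ge : ρ * κ / 64 ≤ d := by nlinarith
  have hd_le : d ≤ ρ * κ / 16 := by nlinarith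
  have hda : 2 * (d + ε) < a * κ := by nlinarith
  have e : S.u c * ((ρ / 2 : ℝ) * Complex.exp (α * Complex.I)) =
      a • S.u c + d • S.nor c := by
    rw [Complex.exp_mul_I, nor, ha, hd, Complex.real_smul, Complex.real_smul]
    push_cast
    ring
  have e' : S.u c * ((ρ / 2 : ℝ) * Complex.exp ((-α : ℝ) * Complex.I)) =
      a • S.u c + -(d • S.nor c) := by
    rw [Complex.exp_mul_I, nor, ha, hd, Complex.real_smul, Complex.real_smul,
      Complex.ofReal_neg, Complex.cos_neg, Complex.sin_neg]
    push_cast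
    ring
  have hnorm : ∀ θ : ℝ, ‖S.u c * ((ρ / 2 : ℝ) * Complex.exp (θ * Complex.I))‖ ≤ ρ / 2 := fun θ => by
    rw [norm_mul, norm_mul, norm_u, Complex.norm_exp_ofReal_mul_I, one_mul, mul_one,
      Complex.norm_real, Real.norm_of_nonneg (by linarith)]
  have hn := hnorm α
  have hn' := hnorm (-α)
  rw [e] at hn ⊢
  rw [e'] at hn' ⊢
  have hd0 : 0 ≤ d := le_trans (by positivity) hd_ge
  have hv : ‖d • S.nor c‖ = d := by
    rw [norm_smul, norm_nor, mul_one, Real.norm_of_nonneg hd0]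
  have hdot : dot (S.nor c) (d • S.nor c) = d := by
    have h1 : (S.nor c).re ^ 2 + (S.nor c).im ^ 2 = 1 := by
      have := Complex.sq_norm (S.nor c)
      rw [norm_nor, Complex.normSq_apply] at this
      linarith
    simp only [dot, Complex.smul_re, Complex.smul_im, smul_eq_mul]
    linear_combination d * h1
  have hdn : ∀ b v : ℂ, dot b (-v) = -dot b v := fun b v => by
    simp [dot]
    ring
  have h1 := F.φ_add_le h hW hv (by rw [hdot]) (by nlinarith) ha_le (by linarith) hda hn
  have h2 := F.φ_add_le h hW (v := -(d • S.nor c)) (by rw [norm_neg, hv])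
    (by rw [hdn, hdot, neg_sq]) (by nlinarith) ha_le (by linarith) hda hn'
  rw [hdn] at h2
  rw [← add_assoc, ← add_assoc]
  have h3 : S.W c * (d * ε ^ 2 / 16) ≤ S.W c * (ρ * κ / 64 * ε ^ 2 / 16) := by
    refine mul_le_mul_of_nonpos_left ?_ hW
    gcongr
  have h4 := hM (S.P (S.s c) + a • S.u c)
  linarith

theorem Scale.le_mul_ε (h : S.Scale κ ρ ε) {ω : ℝ} (hω : ∀ c, S.W c ≠ 0 → ω ≤ |S.W c|)
    {c₀ : C} (hc₀ : S.W c₀ ≠ 0) : ω * ρ * κ ^ 2 / 8192 ≤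
      4 * Real.pi * ((∑ c, |S.W c|) * ((2 + 8 / κ) ^ 2 * (3 + 8 / κ))) * ε := by
  obtain ⟨F⟩ := h.nonempty_potential c₀
  obtain ⟨x, hx, c₁, hc₁, hxc⟩ := F.exists_max_near_center h hc₀
  obtain ⟨c, hs, hW⟩ := exists_W_neg hc₁
  rw [← hs] at hxc
  have hκ := h.κ_pos
  have hκ1 := h.κ_le_one
  have hρ := h.ρ_pos
  have hε := h.ε_pos
  have hωc := hω c hW.ne
  rw [abs_of_neg hW] at hωc
  have hK : (2 + 8 / κ) * ε ≤ ρ / 2 := by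
    have h1 : (2 + 8 / κ) * ε * κ ≤ ρ / 2 * κ := by
      have e : (2 + 8 / κ) * ε * κ = (2 * κ + 8) * ε := by
        field_simp
      rw [e]
      have : ρ * κ ^ 2 ≤ ρ * κ := by gcongr; nlinarith
      nlinarith [h.ε_lt]
    exact le_of_mul_le_mul_right h1 hκ
  have h1 := F.max_sub_le h hK hx hxc.le
  set f : ℝ → ℝ := fun θ =>
    F.φ x - F.φ (S.P (S.s c) + S.u c * ((ρ / 2 : ℝ) * Complex.exp (θ * Complex.I))) with hf
  have hφ := F.continuous_φ
  have hcont : Continuous fun θ : ℝ =>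
    F.φ (S.P (S.s c) + S.u c * ((ρ / 2 : ℝ) * Complex.exp (θ * Complex.I))) := by fun_prop
  have h2 : (∫ θ in -Real.pi..Real.pi, f θ) =
      2 * Real.pi * (F.φ x - F.φ (S.P (S.s c))) := by
    rw [hf, intervalIntegral.integral_sub intervalIntegrable_const
      (hcont.intervalIntegrable _ _), F.circle_mean h c (S.norm_u c),
      intervalIntegral.integral_const, smul_eq_mul]
    ring
  have h3 := integral_symm_ge (f := f) (a := κ / 16) (b := κ / 8) (B := Real.pi)
    (c := ω * (ρ * κ * ε ^ 2 / 512)) (continuous_const.sub hcont)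
    (fun θ => sub_nonneg.2 (hx _)) (by linarith [Real.pi_pos]) (by linarith)
    (by linarith [Real.pi_gt_three]) fun θ hθ => by
      have h4 := F.two_point_le h hW.le hθ.1 hθ.2 hx
      have h5 : ω * (ρ * κ * ε ^ 2 / 512) ≤ -S.W c * (ρ * κ * ε ^ 2 / 512) := by gcongr
      simp only [hf]
      linarith
  rw [h2] at h3
  have h4 := mul_le_mul_of_nonneg_left h1 (by positivity : 0 ≤ 4 * Real.pi)
  have h5 : ω * ρ * κ ^ 2 / 8192 * ε ^ 2 ≤
      4 * Real.pi * ((∑ c, |S.W c|) * ((2 + 8 / κ) ^ 2 * (3 + 8 / κ))) * ε * ε ^ 2 := by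
    linarith
  exact le_of_mul_le_mul_right h5 (by positivity)

theorem exists_pos_le_of_pos {β : Type} [Finite β] (f : β → ℝ) :
    ∃ κ, 0 < κ ∧ κ ≤ 1 ∧ ∀ b, 0 < f b → κ ≤ f b := by
  have h : ∀ᶠ κ in nhdsWithin (0 : ℝ) (Set.Ioi 0), ∀ b, 0 < f b → κ ≤ f b := by
    rw [Filter.eventually_all]
    intro b
    by_cases hb : 0 < f b
    · filter_upwards [Ioo_mem_nhdsGT hb] with κ hκ _ using hκ.2.le
    · exact Filter.Eventually.of_forall fun _ h => absurd h hb
  obtain ⟨κ, h1, h2⟩ := (h.and (Ioo_mem_nhdsGT (zero_lt_one (α := ℝ)))).exists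
  exact ⟨κ, h2.1, h2.2.le, h1⟩

theorem w_eq_zero (S : StressedPacking ι C) : ∀ c, S.w c = 0 := by
  by_contra! hw
  obtain ⟨c₀, hc₀⟩ := hw
  have hW : S.W c₀ ≠ 0 := mul_ne_zero hc₀ (S.L_pos c₀).ne'
  obtain ⟨κ, hκ, hκ1, hκ_le⟩ := exists_pos_le_of_pos fun p : C × C => ‖S.u p.1 - S.u p.2‖
  obtain ⟨ρ, hρ, -, hρ_le⟩ := exists_pos_le_of_pos fun c => S.r (S.s c)
  obtain ⟨ω, hω, -, hω_le⟩ := exists_pos_le_of_pos fun c => |S.W c|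
  set B := 4 * Real.pi * ((∑ c, |S.W c|) * ((2 + 8 / κ) ^ 2 * (3 + 8 / κ))) with hB
  have hev : ∀ᶠ ε in nhdsWithin (0 : ℝ) (Set.Ioi 0), 0 < ε ∧ 8 * ε ≤ ρ ∧ 32 * ε < ρ * κ ^ 2 ∧
      B * ε < ω * ρ * κ ^ 2 / 8192 := by
    have h : ∀ a b : ℝ, 0 < b → ∀ᶠ ε in nhdsWithin (0 : ℝ) (Set.Ioi 0), a * ε < b :=
      fun a b hb => ((continuous_const_mul a).tendsto' 0 0 (mul_zero a)).mono_left
        nhdsWithin_le_nhds |>.eventually_lt_const hb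
    filter_upwards [self_mem_nhdsWithin, h 8 ρ hρ,
      h 32 (ρ * κ ^ 2) (by positivity), h B (ω * ρ * κ ^ 2 / 8192) (by positivity)] with
      ε h0 h1 h2 h3 using ⟨h0, h1.le, h2, h3⟩
  obtain ⟨ε, h0, h1, h2, h3⟩ := hev.exists
  have hS : S.Scale κ ρ ε :=
    ⟨hκ, hκ1, fun c c' h => hκ_le (c, c') (norm_pos_iff.2 (sub_ne_zero.2 h)), hρ,
      fun c => hρ_le c (S.r_pos _), h0, h1, h2⟩
  exact h3.not_ge (hS.le_mul_ε (fun c hc => hω_le c (abs_pos.2 hc)) hW)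

end StressedPacking

/-- The identification of the Euclidean plane with the complex numbers. -/
def toComplex (x : Pt) : ℂ := ⟨x 0, x 1⟩

theorem norm_toComplex (x : Pt) : ‖toComplex x‖ = ‖x‖ := by
  rw [EuclideanSpace.norm_eq, Complex.norm_eq_sqrt_sq_add_sq, Fin.sum_univ_two]
  simp [toComplex]

theorem toComplex_injective : Function.Injective toComplex := by
  intro x y h
  ext i
  fin_cases i
  · exact congrArg Complex.re h
  · exact congrArg Complex.im h

theorem rectVec_injective {b₁ b₂ : ℝ} (h₁ : b₁ ≠ 0) (h₂ : b₂ ≠ 0) :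
    Function.Injective (rectVec b₁ b₂) := by
  intro z z' h
  have h1 := congrArg Complex.re h
  have h2 := congrArg Complex.im h
  simp [rectVec, h₁, h₂] at h1 h2
  exact Prod.ext h1 h2

/-- **Section 7, rectangular-lattice case.**  Let `Λ` be the rectangular lattice with
basis `(a, 0), (0, 1/a)`, `a > 0`, and let `(p, r)` be a collectively jammed packing of
`n` disks in `ℝ²/Λ`.  If the `n` numbers `r₂/r₁, …, rₙ/r₁, a` are generic
(algebraically independent over `ℚ`), then the number of contacts is at most `2n`
(the set `K` of ordered contact triples has at most `2·2n` elements). -/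
theorem rectangular_lattice_contact_bound
    (n : ℕ) (hn : 0 < n) (a : ℝ) (ha : 0 < a)
    (p : Fin n → Pt) (r : Fin n → ℝ)
    (hpack : IsPacking (lat (vec a 0) (vec 0 (1 / a))) p r)
    (hjam : CollectivelyJammed (lat (vec a 0) (vec 0 (1 / a))) p r)
    (hgen : AlgebraicIndependent ℚ (fun x : Option (Fin (n - 1)) =>
      match x with
      | some i => r ⟨(i : ℕ) + 1, by have := i.isLt; omega⟩ / r ⟨0, hn⟩
      | none => a))
    (K : Finset (Fin n × Fin n × Pt))
    (hK : ∀ c, c ∈ K ↔ IsContact (lat (vec a 0) (vec 0 (1 / a))) p r c) :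
    K.card ≤ 2 * (2 * n) := by
  classical
  let z : Fin n × Fin n × Pt → Fin n × Fin n × ℤ × ℤ := fun c =>
    (c.1, c.2.1, if h : ∃ z : ℤ × ℤ, toComplex c.2.2 = rectVec a (1 / a) z then h.choose else 0)
  have hz : ∀ c ∈ K, toComplex c.2.2 = rectVec a (1 / a) (z c).2.2 := by
    intro c hc
    have h : ∃ z : ℤ × ℤ, toComplex c.2.2 = rectVec a (1 / a) z := by
      obtain ⟨z₁, z₂, h⟩ := ((hK c).1 hc).1
      exact ⟨(z₁, z₂), by simp [toComplex, h, vec, rectVec]⟩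
    simp only [z, dif_pos h]
    exact h.choose_spec
  have hinj : Set.InjOn z K := by
    rintro ⟨i, j, l⟩ hc ⟨i', j', l'⟩ hc' h
    have h1 := hz _ hc
    rw [h, ← hz _ hc'] at h1
    have h2 := toComplex_injective h1
    simp only [z, Prod.mk.injEq] at h
    exact Prod.ext h.1 (Prod.ext h.2.1 h2)
  rw [← Finset.card_image_of_injOn hinj]
  have hb : (0 : ℝ) < 1 / a := by positivity
  have hgen' : AlgebraicIndependent ℚ fun x : Option (Fin (n - 1)) =>
      x.elim a fun i => r (positive hn i) / r ⟨0, hn⟩ := by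
    convert hgen with x
    cases x <;> rfl
  refine card_le_of_weight_eq_zero hn ha (fun i => toComplex (p i)) r hpack.1 ?_ hgen' _ ?_ ?_
    fun S => S.w_eq_zero
  · rintro i j ⟨z₁, z₂⟩ h
    have := hpack.2 i j ((z₁ : ℝ) • vec a 0 + (z₂ : ℝ) • vec 0 (1 / a)) ⟨z₁, z₂, rfl⟩ (by
      rintro ⟨rfl, h0⟩
      have h1 := congrArg (fun v : Pt => v 0) h0
      have h2 := congrArg (fun v : Pt => v 1) h0
      simp [vec, ha.ne'] at h1 h2
      exact h ⟨rfl, by simp [h1, h2]⟩)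
    convert this using 1
    rw [← norm_toComplex]
    congr 1
    apply Complex.ext <;> simp [toComplex, rectVec, vec]
  · intro c' hc'
    obtain ⟨c, hc, rfl⟩ := Finset.mem_image.1 hc'
    rw [← hz c hc]
    have := ((hK c).1 hc).2.2
    rw [← norm_toComplex] at this
    simp only [z]
    rw [← this]
    congr 1
  · intro c' hc'
    obtain ⟨c, hc, rfl⟩ := Finset.mem_image.1 hc'
    have h := (hK c).1 hc
    have hmem : (c.2.1, c.1, -c.2.2) ∈ K := by
      refine (hK _).2 ⟨?_, ?_, ?_⟩
      · obtain ⟨z₁, z₂, h⟩ := h.1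
        refine ⟨-z₁, -z₂, ?_⟩
        simp only [h]
        push_cast
        module
      · rintro ⟨h1, h2⟩
        exact h.2.1 ⟨h1.symm, neg_eq_zero.1 h2⟩
      · rw [add_comm (r _), ← h.2.2, ← norm_neg]
        congr 1
        simp only
        abel
    refine Finset.mem_image.2 ⟨_, hmem, ?_⟩
    refine Prod.ext rfl (Prod.ext rfl (rectVec_injective ha.ne' hb.ne' ?_))
    rw [← hz _ hmem]
    simp only [contactRev]
    rw [rectVec_neg, ← hz c hc]
    apply Complex.ext <;> simp [toComplex]

end IsostaticPaper
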